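/- For every ε > 0 there is a constant c_ε > 0 such that the following holds. Let p be a prime, let Y ⊆ F_p \ {0} be nonempty, let C ⊆ F_p with |C| ≤ p^{1/2}, and let E = C × C. Then there exists y ∈ Y such that #{a·y + b : (a, b) ∈ E} ≥ c_ε · p^{−ε} · min( |Y|^{1/2} |C|^{10/13}, |C|^2 ). -/

import Mathlib

namespace Incidence

section PointPlane
open scoped Polynomial
open MvPolynomial

variable {K : Type*} [Field K]

/-- Polynomials in three variables whose degree in the `i`-th variable is at most `D i`. -/
noncomputable def box (K : Type*) [Field K] (D : Fin 3 → ℕ) : Submodule K (MvPolynomial (Fin 3) K) :=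
  restrictSupport K {m | ∀ i, m i ≤ D i}

lemma mem_box {D : Fin 3 → ℕ} {f : MvPolynomial (Fin 3) K} :
    f ∈ box K D ↔ ∀ i, degreeOf i f ≤ D i := by
  rw [box, mem_restrictSupport_iff]
  simp only [degreeOf_le_iff]
  constructor
  · intro h i m hm
    exact h hm i
  · intro h m hm i
    exact h i m hm

lemma setOf_eq_Iic (D : Fin 3 → ℕ) :
    {m : Fin 3 →₀ ℕ | ∀ i, m i ≤ D i} = ↑(Finset.Iic (Finsupp.equivFunOnFinite.symm D)) := by
  ext m
  simp [Finsupp.le_def]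

instance (D : Fin 3 → ℕ) : Finite {m : Fin 3 →₀ ℕ | ∀ i, m i ≤ D i} := by
  rw [setOf_eq_Iic]
  exact Finset.finite_toSet _

instance (D : Fin 3 → ℕ) : Module.Finite K (box K D) :=
  Module.Finite.of_basis (basisRestrictSupport K {m : Fin 3 →₀ ℕ | ∀ i, m i ≤ D i})

lemma finrank_box (D : Fin 3 → ℕ) : Module.finrank K (box K D) = ∏ i, (D i + 1) := by
  rw [box, Module.finrank_eq_nat_card_basis (basisRestrictSupport K _), setOf_eq_Iic,
    Nat.card_eq_card_toFinset]
  simp only [Finset.toFinset_coe, Finsupp.card_Iic, Nat.card_Iic]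
  refine Finset.prod_subset (Finset.subset_univ _) ?_
  intro i _ hi
  simpa using hi

/-- Restriction of a polynomial to the parametrized line `t ↦ u + t v`. -/
noncomputable def lineHom (u v : Fin 3 → K) : MvPolynomial (Fin 3) K →ₐ[K] K[X] :=
  aeval (fun i => Polynomial.C (u i) + Polynomial.C (v i) * Polynomial.X)

@[simp] lemma lineHom_X (u v : Fin 3 → K) (i : Fin 3) :
    lineHom u v (X i) = Polynomial.C (u i) + Polynomial.C (v i) * Polynomial.X := by
  simp [lineHom]

lemma natDegree_lineHom_le (u v : Fin 3 → K) (f : MvPolynomial (Fin 3) K) :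
    (lineHom u v f).natDegree ≤ f.totalDegree := by
  have := aeval_natDegree_le f le_rfl
    (fun i => Polynomial.C (u i) + Polynomial.C (v i) * Polynomial.X) (n := 1) ?_
  · rw [mul_one] at this
    exact this
  · intro i
    compute_degree

lemma eval_lineHom (u v : Fin 3 → K) (s : K) (f : MvPolynomial (Fin 3) K) :
    (lineHom u v f).eval s = eval (fun i => u i + s * v i) f := by
  induction f using MvPolynomial.induction_on with
  | C a => simp [lineHom]
  | add p q hp hq => simp [hp, hq]
  | mul_X p j hp =>
    rw [map_mul, map_mul, Polynomial.eval_mul, hp]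
    simp [mul_comm s]

lemma lineHom_reparam (u v : Fin 3 → K) (a b : K) (f : MvPolynomial (Fin 3) K) :
    lineHom (fun i => u i + a * v i) (fun i => b * v i) f =
      (lineHom u v f).comp (Polynomial.C a + Polynomial.C b * Polynomial.X) := by
  have : lineHom (fun i => u i + a * v i) (fun i => b * v i) =
      (Polynomial.compRingHom (Polynomial.C a + Polynomial.C b * Polynomial.X) :
        K[X] →+* K[X]).comp (lineHom u v : MvPolynomial (Fin 3) K →+* K[X]) := by
    apply MvPolynomial.ringHom_ext
    · intro r
      simp [lineHom]
    · intro i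
      simp
      ring
  exact DFunLike.congr_fun this f

lemma derivative_lineHom (u v : Fin 3 → K) (f : MvPolynomial (Fin 3) K) :
    Polynomial.derivative (lineHom u v f) =
      ∑ i, Polynomial.C (v i) * lineHom u v (pderiv i f) := by
  induction f using MvPolynomial.induction_on with
  | C a => simp [lineHom]
  | add p q hp hq => simp only [map_add, hp, hq, mul_add, Finset.sum_add_distrib]
  | mul_X p j hp =>
    simp only [map_mul, Polynomial.derivative_mul, hp, pderiv_mul, map_add, lineHom_X,
      Fin.sum_univ_three, pderiv_X]
    fin_cases j <;> simp <;> ring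

lemma exists_vanishing {ι : Type*} (s : Finset ι) (u v : ι → Fin 3 → K) (D : ℕ)
    (h : s.card * (3 * D + 1) < (D + 1) ^ 3) :
    ∃ f : MvPolynomial (Fin 3) K, f ≠ 0 ∧ f.totalDegree ≤ 3 * D ∧
      ∀ j ∈ s, lineHom (u j) (v j) f = 0 := by
  have hdeg : ∀ f ∈ box K (fun _ => D), f.totalDegree ≤ 3 * D := by
    intro f hf
    refine Finset.sup_le fun m hm => ?_
    have h3 : ∀ i, m i ≤ D := fun i => hf hm i
    rw [Finsupp.sum_fintype _ _ (fun _ => rfl), Fin.sum_univ_three]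
    linarith [h3 0, h3 1, h3 2]
  let T : box K (fun _ => D) →ₗ[K] (s → Polynomial.degreeLT K (3 * D + 1)) :=
    LinearMap.pi fun j => LinearMap.codRestrict _
      ((lineHom (u j) (v j)).toLinearMap ∘ₗ (box K _).subtype) (by
        rintro ⟨f, hf⟩
        rw [Polynomial.mem_degreeLT]
        simp only [LinearMap.comp_apply, Submodule.subtype_apply, AlgHom.toLinearMap_apply]
        refine lt_of_le_of_lt Polynomial.degree_le_natDegree ?_
        have := (natDegree_lineHom_le (u j) (v j) f).trans (hdeg f hf)
        exact_mod_cast Nat.lt_succ_of_le this)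
  have hk : LinearMap.ker T ≠ ⊥ := by
    apply LinearMap.ker_ne_bot_of_finrank_lt
    rw [Module.finrank_pi_fintype, finrank_box]
    simp [(Polynomial.degreeLTEquiv K (3 * D + 1)).finrank_eq]
    simpa [Fin.prod_univ_succ, pow_succ, mul_assoc] using h
  obtain ⟨⟨f, hf⟩, hfk, hne⟩ := Submodule.exists_mem_ne_zero_of_ne_bot hk
  refine ⟨f, fun h0 => hne (by simp [h0]), hdeg f hf, fun j hj => ?_⟩
  have := congrFun (LinearMap.mem_ker.1 hfk) ⟨j, hj⟩
  simpa [T] using congrArg Subtype.val this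

lemma bezout_arith {n D e₀ e₁ e₂ h₀ h₁ h₂ x₀ x₁ x₂ : ℕ} (hx₀ : D = e₀ + h₀ + x₀)
    (hx₁ : D = e₁ + h₁ + x₁) (hx₂ : D = e₂ + h₂ + x₂)
    (main : (h₀ + x₀ + 1) * (h₁ + x₁ + 1) * (h₂ + x₂ + 1) +
      (e₀ + x₀ + 1) * (e₁ + x₁ + 1) * (e₂ + x₂ + 1) + n * (D + 1) ≤
      (D + 1) * (D + 1) * (D + 1) + (x₀ + 1) * (x₁ + 1) * (x₂ + 1)) :
    n * (D + 1) ≤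
      (D + 1) * (e₀ * h₁ + e₁ * h₀ + e₀ * h₂ + e₂ * h₀ + e₁ * h₂ + e₂ * h₁) := by
  zify at main hx₀ hx₁ hx₂ ⊢
  have d0 : (x₀ : ℤ) = D - e₀ - h₀ := by linarith
  have d1 : (x₁ : ℤ) = D - e₁ - h₁ := by linarith
  have d2 : (x₂ : ℤ) = D - e₂ - h₂ := by linarith
  rw [d0, d1, d2] at main
  have hp : (0 : ℤ) ≤ (e₀ : ℤ) * e₁ * h₂ + e₀ * h₁ * e₂ + e₀ * h₁ * h₂ + h₀ * e₁ * e₂ +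
    h₀ * e₁ * h₂ + h₀ * h₁ * e₂ := by positivity
  linarith

/-- A Bézout bound for parallel-slice lines: a surface `G = 0` with `G` prime and a surface
`H = 0` not containing it share few lines lying in distinct planes `X i₀ = const`. -/
lemma card_lines_le {ι : Type*} (J : Finset ι) (u v : ι → Fin 3 → K) (i₀ i₁ : Fin 3)
    (hu₁ : ∀ j ∈ J, u j i₁ = 0) (hv₁ : ∀ j ∈ J, v j i₁ = 1) (hv₀ : ∀ j ∈ J, v j i₀ = 0)
    (hinj : Set.InjOn (fun j => u j i₀) J) {G H : MvPolynomial (Fin 3) K} (hG : Prime G)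
    (hGH : ¬ G ∣ H) (hJG : ∀ j ∈ J, lineHom (u j) (v j) G = 0)
    (hJH : ∀ j ∈ J, lineHom (u j) (v j) H = 0) :
    J.card ≤ 6 * G.totalDegree * H.totalDegree := by
  classical
  have hH : H ≠ 0 := by
    rintro rfl
    exact hGH (dvd_zero _)
  have hG0 : G ≠ 0 := hG.ne_zero
  have hi : ∀ j ∈ J, i₀ ≠ i₁ := by
    rintro j hj rfl
    have := (hv₀ j hj).symm.trans (hv₁ j hj)
    exact zero_ne_one this
  set e : Fin 3 → ℕ := fun i => degreeOf i G
  set h : Fin 3 → ℕ := fun i => degreeOf i H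
  set D : ℕ := J.card + G.totalDegree + H.totalDegree with hD
  have he : ∀ i, e i ≤ G.totalDegree := fun i => degreeOf_le_totalDegree G i
  have hh : ∀ i, h i ≤ H.totalDegree := fun i => degreeOf_le_totalDegree H i
  let lag : ι → MvPolynomial (Fin 3) K := fun j => ∏ i ∈ J.erase j, (X i₀ - C (u i i₀))
  let mono : J × Fin (D + 1) → MvPolynomial (Fin 3) K := fun x => X i₁ ^ (x.2 : ℕ) * lag x.1
  have hmono : ∀ x, mono x ∈ box K (fun _ => D) := by
    rintro ⟨⟨j, hj⟩, k⟩
    rw [mem_box]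
    intro i
    have h1 : degreeOf i (lag j) ≤ if i = i₀ then J.card else 0 := by
      refine (degreeOf_prod_le _ _ _).trans ?_
      refine (Finset.sum_le_card_nsmul _ _ (if i = i₀ then 1 else 0) ?_).trans ?_
      · intro l _
        refine (degreeOf_sub_le _ _ _).trans ?_
        rw [degreeOf_C, degreeOf_X]
        simp
      · have := Finset.card_le_card (Finset.erase_subset j J)
        split_ifs <;> simp [this]
    have h2 : degreeOf i (X i₁ ^ (k : ℕ) : MvPolynomial (Fin 3) K) ≤ if i = i₁ then D else 0 := by
      refine (degreeOf_pow_le _ _ _).trans ?_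
      rw [degreeOf_X]
      split_ifs
      · simpa using Nat.lt_succ_iff.1 k.2
      · simp
    refine (degreeOf_mul_le _ _ _).trans ((add_le_add h2 h1).trans ?_)
    have := hi j hj
    have hJD : J.card ≤ D := by omega
    split_ifs with ha hb
    · exact absurd (hb.symm.trans ha) this
    all_goals omega
  have hmulG : ∀ V : box K (fun i => D - e i), G * V.1 ∈ box K (fun _ => D) := by
    intro V
    rw [mem_box]
    intro i
    have h1 := mem_box.1 V.2 i
    have h2 := degreeOf_mul_le i G V.1
    have h3 := he i
    simp only [e] at *
    omega
  have hmulH : ∀ V : box K (fun i => D - h i), H * V.1 ∈ box K (fun _ => D) := by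
    intro V
    rw [mem_box]
    intro i
    have h1 := mem_box.1 V.2 i
    have h2 := degreeOf_mul_le i H V.1
    have h3 := hh i
    simp only [h] at *
    omega
  let Φ₁ : (box K (fun i => D - e i) × box K (fun i => D - h i)) × (J × Fin (D + 1) → K) →ₗ[K]
      MvPolynomial (Fin 3) K :=
    ((LinearMap.mulLeft K G ∘ₗ (box K _).subtype).coprod
      (LinearMap.mulLeft K H ∘ₗ (box K _).subtype)).coprod (Fintype.linearCombination K mono)
  have hΦ₁ : ∀ x, Φ₁ x = G * x.1.1 + H * x.1.2 + ∑ z, x.2 z • mono z := by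
    intro x
    simp [Φ₁, Fintype.linearCombination_apply]
  let Φ : (box K (fun i => D - e i) × box K (fun i => D - h i)) × (J × Fin (D + 1) → K) →ₗ[K]
      box K (fun _ => D) := LinearMap.codRestrict _ Φ₁ (by
        intro x
        rw [hΦ₁]
        exact add_mem (add_mem (hmulG _) (hmulH _))
          (Submodule.sum_mem _ fun z _ => Submodule.smul_mem _ _ (hmono z)))
  let Ψ : box K (fun i => D - e i - h i) →ₗ[K]
      (box K (fun i => D - e i) × box K (fun i => D - h i)) × (J × Fin (D + 1) → K) :=
    (LinearMap.prod
      (LinearMap.codRestrict _ (-(LinearMap.mulLeft K H ∘ₗ (box K _).subtype)) (by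
        intro W
        simp only [LinearMap.neg_apply, LinearMap.comp_apply, LinearMap.mulLeft_apply,
          Submodule.subtype_apply]
        refine neg_mem (mem_box.2 fun i => (degreeOf_mul_le _ _ _).trans ?_)
        have h1 := mem_box.1 W.2 i
        have h3 := he i
        have h4 := hh i
        simp only [e, h] at *
        omega))
      (LinearMap.codRestrict _ (LinearMap.mulLeft K G ∘ₗ (box K _).subtype) (by
        intro W
        simp only [LinearMap.comp_apply, LinearMap.mulLeft_apply, Submodule.subtype_apply]
        refine mem_box.2 fun i => (degreeOf_mul_le _ _ _).trans ?_
        have h1 := mem_box.1 W.2 i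
        have h3 := he i
        have h4 := hh i
        simp only [e, h] at *
        omega))).prod 0
  have hker : LinearMap.ker Φ ≤ LinearMap.range Ψ := by
    rintro ⟨⟨⟨U, hU⟩, ⟨V, hV⟩⟩, x⟩ hx
    have hx' : G * U + H * V + ∑ z, x z • mono z = 0 := by
      have := congrArg Subtype.val (LinearMap.mem_ker.1 hx)
      rwa [LinearMap.codRestrict_apply, hΦ₁] at this
    have hx0 : x = 0 := by
      ext ⟨⟨j, hj⟩, k⟩
      have hL := congrArg (lineHom (u j) (v j)) hx'
      have hlag : ∀ i ∈ J, lineHom (u j) (v j) (lag i) =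
          if i = j then Polynomial.C (∏ i ∈ J.erase j, (u j i₀ - u i i₀)) else 0 := by
        intro i hiJ
        split_ifs with hij
        · subst hij
          simp [lag, hv₀ i hj, map_prod]
        · simp only [lag, map_prod]
          exact Finset.prod_eq_zero (Finset.mem_erase.2 ⟨Ne.symm hij, hj⟩) (by simp [hv₀ j hj])
      have hne : ∏ i ∈ J.erase j, (u j i₀ - u i i₀) ≠ 0 := by
        rw [Finset.prod_ne_zero_iff]
        intro i hi' h0
        rw [Finset.mem_erase] at hi'
        exact hi'.1 (hinj hi'.2 hj (sub_eq_zero.1 h0).symm)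
      simp only [map_add, map_mul, hJG j hj, hJH j hj, zero_mul, zero_add, map_sum, map_smul,
        map_zero, mono, map_pow, lineHom_X, hu₁ j hj, hv₁ j hj, Fintype.sum_prod_type] at hL
      rw [Finset.sum_eq_single ⟨j, hj⟩] at hL
      · simp only [hlag j hj, if_true, Polynomial.C_1, one_mul] at hL
        have hc := congrArg (fun q => Polynomial.coeff q k) hL
        simp only [Polynomial.finsetSum_coeff, Polynomial.coeff_smul, Polynomial.coeff_mul_C,
          Polynomial.coeff_X_pow, Polynomial.coeff_zero, smul_eq_mul] at hc
        rw [Finset.sum_eq_single k] at hc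
        · simpa [hne] using hc
        · intro l _ hl
          have : (k : ℕ) ≠ l := fun h' => hl (Fin.ext h'.symm)
          simp [this]
        · simp
      · rintro ⟨i, hiJ⟩ _ hij
        refine Finset.sum_eq_zero fun l _ => ?_
        have : i ≠ j := fun h' => hij (Subtype.ext h')
        simp [hlag i hiJ, this]
      · simp
    subst hx0
    have hUV : G * U + H * V = 0 := by simpa using hx'
    have hdv : G ∣ H * V := ⟨-U, by linear_combination hUV⟩
    obtain ⟨W, rfl⟩ := (hG.dvd_or_dvd hdv).resolve_left hGH
    have hUW : U = -(H * W) := by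
      apply mul_left_cancel₀ hG0
      linear_combination hUV
    have hW : W ∈ box K (fun i => D - e i - h i) := by
      rw [mem_box]
      intro i
      by_cases hW0 : W = 0
      · simp [hW0]
      have h1 := mem_box.1 hV i
      rw [degreeOf_mul_eq hG0 hW0] at h1
      have h3 := he i
      have h4 := hh i
      simp only [e, h] at *
      omega
    refine ⟨⟨W, hW⟩, ?_⟩
    exact Prod.ext (Prod.ext (Subtype.ext hUW.symm) rfl) rfl
  have hrank := LinearMap.finrank_range_add_finrank_ker Φ
  have h1 : Module.finrank K (LinearMap.ker Φ) ≤ ∏ i, (D - e i - h i + 1) :=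
    (Submodule.finrank_mono hker).trans ((LinearMap.finrank_range_le Ψ).trans (finrank_box _).le)
  have h2 : Module.finrank K (LinearMap.range Φ) ≤ ∏ i : Fin 3, (D + 1) :=
    (Submodule.finrank_le _).trans (finrank_box (K := K) (fun _ => D)).le
  rw [Module.finrank_prod, Module.finrank_prod, finrank_box, finrank_box, Module.finrank_fintype_fun_eq_card] at hrank
  simp only [Fintype.card_prod, Fintype.card_coe, Fintype.card_fin, Fin.prod_univ_three] at hrank h1 h2
  have hE : ∀ i, e i + h i ≤ D := fun i => by have := he i; have := hh i; omega
  obtain ⟨x0, hx0⟩ := Nat.exists_eq_add_of_le (hE 0)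
  obtain ⟨x1, hx1⟩ := Nat.exists_eq_add_of_le (hE 1)
  obtain ⟨x2, hx2⟩ := Nat.exists_eq_add_of_le (hE 2)
  have key : J.card * (D + 1) ≤ (D + 1) * (e 0 * h 1 + e 1 * h 0 + e 0 * h 2 + e 2 * h 0 + e 1 * h 2
      + e 2 * h 1) := by
    have a0 : D - e 0 = h 0 + x0 := by omega
    have a1 : D - e 1 = h 1 + x1 := by omega
    have a2 : D - e 2 = h 2 + x2 := by omega
    have b0 : D - h 0 = e 0 + x0 := by omega
    have b1 : D - h 1 = e 1 + x1 := by omega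
    have b2 : D - h 2 = e 2 + x2 := by omega
    rw [a0, a1, a2, b0, b1, b2] at hrank
    have c0 : D - e 0 - h 0 = x0 := by omega
    have c1 : D - e 1 - h 1 = x1 := by omega
    have c2 : D - e 2 - h 2 = x2 := by omega
    rw [c0, c1, c2] at h1
    have main : (h 0 + x0 + 1) * (h 1 + x1 + 1) * (h 2 + x2 + 1) + (e 0 + x0 + 1) * (e 1 + x1 + 1) * (e 2 + x2 + 1)
      + J.card * (D + 1) ≤ (D + 1) * (D + 1) * (D + 1) + (x0 + 1) * (x1 + 1) * (x2 + 1) := by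
      linarith
    exact bezout_arith hx0 hx1 hx2 main
  have key2 : J.card ≤ e 0 * h 1 + e 1 * h 0 + e 0 * h 2 + e 2 * h 0 + e 1 * h 2 + e 2 * h 1 := by
    rw [mul_comm] at key
    exact Nat.le_of_mul_le_mul_left key (Nat.succ_pos D)
  have key3 : ∀ i j, e i * h j ≤ G.totalDegree * H.totalDegree := fun i j =>
    Nat.mul_le_mul (he i) (hh j)
  linarith [key3 0 1, key3 1 0, key3 0 2, key3 2 0, key3 1 2, key3 2 1]

lemma totalDegree_pderiv_le (i : Fin 3) (f : MvPolynomial (Fin 3) K) :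
    (pderiv i f).totalDegree ≤ f.totalDegree := by
  refine Finset.sup_le fun m hm => ?_
  rw [mem_support_iff, coeff_pderiv] at hm
  have h1 : m + Finsupp.single i 1 ∈ f.support := mem_support_iff.2 (left_ne_zero_of_mul hm)
  refine le_trans ?_ (le_totalDegree h1)
  rw [Finsupp.sum_fintype _ _ (fun _ => rfl), Finsupp.sum_fintype _ _ (fun _ => rfl)]
  exact Finset.sum_le_sum fun j _ => by simp

/-- If `∂ᵢ f = 0` and `f` has degree less than the characteristic, then `f` does not involve the
variable `Xᵢ`. -/
lemma notMem_vars_of_pderiv_eq_zero {p : ℕ} [CharP K p] {i : Fin 3} {f : MvPolynomial (Fin 3) K}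
    (hd : f.totalDegree < p) (h : pderiv i f = 0) : i ∉ f.vars := by
  rw [mem_vars_iff_mem_support]
  rintro ⟨m, hm, hi⟩
  have hmi : 0 < m i := Nat.pos_of_ne_zero (Finsupp.mem_support_iff.1 hi)
  have hc := coeff_pderiv f (i := i) (m := m - Finsupp.single i 1)
  have hadd : m - Finsupp.single i 1 + Finsupp.single i 1 = m := by
    ext j
    by_cases hj : j = i
    · subst hj
      simp
      omega
    · simp [Ne.symm hj]
  rw [h, hadd] at hc
  have hcast : (((m - Finsupp.single i 1 : Fin 3 →₀ ℕ) i : ℕ) : K) + 1 = (m i : K) := by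
    rw [Finsupp.coe_tsub, Pi.sub_apply, Finsupp.single_eq_same]
    push_cast [Nat.cast_sub hmi]
    ring
  rw [hcast, coeff_zero] at hc
  have hmd : m i ≤ f.totalDegree :=
    ((degreeOf_le_iff).1 le_rfl m hm).trans (degreeOf_le_totalDegree f i)
  rcases mul_eq_zero.1 hc.symm with h0 | h0
  · exact mem_support_iff.1 hm h0
  · rw [CharP.cast_eq_zero_iff K p] at h0
    exact absurd (Nat.le_of_dvd hmi h0) (by omega)

lemma not_dvd_pderiv {i : Fin 3} {f : MvPolynomial (Fin 3) K} (hi : pderiv i f ≠ 0) :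
    ¬ f ∣ pderiv i f := by
  rintro ⟨q, hq⟩
  have hf : f ≠ 0 := by
    rintro rfl
    simp at hi
  have hq0 : q ≠ 0 := by
    rintro rfl
    exact hi (by simp [hq])
  have h1 : degreeOf i f ≤ degreeOf i (pderiv i f) := by
    rw [hq, degreeOf_mul_eq hf hq0]
    omega
  have h2 : degreeOf i (pderiv i f) ≤ degreeOf i f - 1 := by
    rw [degreeOf_le_iff]
    intro m hm
    rw [mem_support_iff, coeff_pderiv] at hm
    have h1 : m + Finsupp.single i 1 ∈ f.support := mem_support_iff.2 (left_ne_zero_of_mul hm)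
    have := (degreeOf_le_iff).1 (le_refl (degreeOf i f)) _ h1
    simp at this
    omega
  have h3 : degreeOf i f = 0 := by omega
  apply hi
  apply pderiv_eq_zero_of_notMem_vars
  rw [mem_vars_iff_mem_support]
  rintro ⟨m, hm, him⟩
  have := (degreeOf_le_iff).1 h3.le m hm
  exact Finsupp.mem_support_iff.1 him (by omega)

lemma pderiv_comm (i j : Fin 3) (f : MvPolynomial (Fin 3) K) :
    pderiv i (pderiv j f) = pderiv j (pderiv i f) := by
  have : (⁅(pderiv i : Derivation K (MvPolynomial (Fin 3) K) (MvPolynomial (Fin 3) K)),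
      pderiv j⁆ : Derivation K (MvPolynomial (Fin 3) K) (MvPolynomial (Fin 3) K)) = 0 := by
    refine derivation_ext fun l => ?_
    simp only [Derivation.commutator_apply, pderiv_X, Derivation.zero_apply]
    have h : ∀ a b c : Fin 3,
        pderiv a ((Pi.single b 1 : Fin 3 → MvPolynomial (Fin 3) K) c) = 0 := by
      intro a b c
      rw [Pi.single_apply]
      split_ifs <;> simp
    rw [h, h, sub_zero]
  exact sub_eq_zero.1 (DFunLike.congr_fun this f)

/-- The second derivative of `f` along the tangent direction `(∂ⱼf) eᵢ - (∂ᵢf) eⱼ`. -/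
noncomputable def hess (i j : Fin 3) (f : MvPolynomial (Fin 3) K) : MvPolynomial (Fin 3) K :=
  pderiv i (pderiv i f) * pderiv j f ^ 2 - 2 * pderiv j (pderiv i f) * pderiv i f * pderiv j f +
    pderiv j (pderiv j f) * pderiv i f ^ 2

lemma totalDegree_hess_le (i j : Fin 3) (f : MvPolynomial (Fin 3) K) :
    (hess i j f).totalDegree ≤ 3 * f.totalDegree := by
  have h1 : ∀ i, (pderiv i f).totalDegree ≤ f.totalDegree := fun i => totalDegree_pderiv_le i f
  have h2 : ∀ i j, (pderiv i (pderiv j f)).totalDegree ≤ f.totalDegree := fun i j =>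
    (totalDegree_pderiv_le i _).trans (h1 j)
  have h3 : ∀ a b c : MvPolynomial (Fin 3) K, a.totalDegree ≤ f.totalDegree →
      b.totalDegree ≤ f.totalDegree → c.totalDegree ≤ f.totalDegree →
      (a * b * c).totalDegree ≤ 3 * f.totalDegree := by
    intro a b c ha hb hc
    have := totalDegree_mul (a * b) c
    have := totalDegree_mul a b
    omega
  have h4 : hess i j f = pderiv i (pderiv i f) * pderiv j f * pderiv j f +
      ((-2 : K) • (pderiv j (pderiv i f) * pderiv i f * pderiv j f) +
      pderiv j (pderiv j f) * pderiv i f * pderiv i f) := by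
    rw [hess, smul_eq_C_mul]
    simp only [map_neg, map_ofNat]
    ring
  rw [h4]
  refine (totalDegree_add _ _).trans (max_le (h3 _ _ _ (h2 _ _) (h1 _) (h1 _)) ?_)
  refine (totalDegree_add _ _).trans (max_le ?_ (h3 _ _ _ (h2 _ _) (h1 _) (h1 _)))
  exact (totalDegree_smul_le _ _).trans (h3 _ _ _ (h2 _ _) (h1 _) (h1 _))

lemma lineHom_hess {u v : Fin 3 → K} {i j : Fin 3} (hij : i ≠ j) (hvi : v i = 1)
    (hv : ∀ l, l ≠ i → l ≠ j → v l = 0) {f : MvPolynomial (Fin 3) K} (hf : lineHom u v f = 0) :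
    lineHom u v (hess i j f) = 0 := by
  have hsum : ∀ g : Fin 3 → K[X], ∑ l, Polynomial.C (v l) * g l =
      g i + Polynomial.C (v j) * g j := by
    intro g
    rw [Fintype.sum_eq_add i j hij]
    · simp [hvi]
    · rintro l ⟨h1, h2⟩
      simp [hv l h1 h2]
  have hD : ∀ g, Polynomial.derivative (lineHom u v g) =
      lineHom u v (pderiv i g) + Polynomial.C (v j) * lineHom u v (pderiv j g) := by
    intro g
    rw [derivative_lineHom, hsum]
  have h1 := hD f
  rw [hf, Polynomial.derivative_zero] at h1
  have h2 := congrArg Polynomial.derivative h1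
  simp only [Polynomial.derivative_zero, Polynomial.derivative_add, Polynomial.derivative_mul,
    Polynomial.derivative_C, zero_mul, zero_add, hD] at h2
  have hcomm : pderiv i (pderiv j f) = pderiv j (pderiv i f) :=
    pderiv_comm i j f
  rw [hcomm] at h2
  simp only [hess, map_add, map_sub, map_mul, map_pow, map_ofNat]
  have h3 : lineHom u v (pderiv i f) = -(Polynomial.C (v j) * lineHom u v (pderiv j f)) := by
    linear_combination -h1
  rw [h3]
  linear_combination -(lineHom u v (pderiv j f)) ^ 2 * h2

lemma natDegree_aeval_le {A : Type*} [CommRing A] [Algebra K A] (φ : Fin 3 → Polynomial A)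
    (hφ : ∀ l, (φ l).natDegree ≤ 1) (f : MvPolynomial (Fin 3) K) :
    (aeval φ f).natDegree ≤ f.totalDegree := by
  have h := aeval_natDegree_le (map (algebraMap K A) f) le_rfl φ hφ
  rw [aeval_map_algebraMap, mul_one] at h
  exact h.trans (Finset.sup_mono (support_map_subset _ _))

lemma derivation_algHom {A : Type*} [CommRing A] [Algebra K A] (d : Derivation K A A)
    (φ : MvPolynomial (Fin 3) K →ₐ[K] A) (g : MvPolynomial (Fin 3) K) :
    d (φ g) = ∑ l, d (φ (X l)) * φ (pderiv l g) := by
  induction g using MvPolynomial.induction_on with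
  | C a => simp [← algebraMap_eq]
  | add p q hp hq => simp only [map_add, hp, hq, mul_add, Finset.sum_add_distrib]
  | mul_X p j hp =>
    simp only [map_mul, Derivation.leibniz, hp, map_add, smul_eq_mul,
      Fin.sum_univ_three, pderiv_X]
    fin_cases j <;> simp <;> ring

/-- The tangent direction `(∂ⱼf) eᵢ - (∂ᵢf) eⱼ`. -/
noncomputable def tangent (i j : Fin 3) (f : MvPolynomial (Fin 3) K) (l : Fin 3) :
    MvPolynomial (Fin 3) K :=
  if l = i then pderiv j f else if l = j then -pderiv i f else 0

lemma dvd_coeff_tangent_expansion {p : ℕ} [CharP K p] {i j : Fin 3} (hij : i ≠ j)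
    {f : MvPolynomial (Fin 3) K} (hf : Prime f) (hd : f.totalDegree < p) (hH : f ∣ hess i j f)
    (ha : ¬ f ∣ pderiv i f) (n : ℕ) :
    f ∣ (aeval (fun l => Polynomial.C (X l) + Polynomial.C (tangent i j f l) * Polynomial.X) f :
      Polynomial (MvPolynomial (Fin 3) K)).coeff n := by
  set Θ : MvPolynomial (Fin 3) K →ₐ[K] Polynomial (MvPolynomial (Fin 3) K) :=
    aeval (fun l => Polynomial.C (X l) + Polynomial.C (tangent i j f l) * Polynomial.X) with hΘ
  have hΘX : ∀ l, Θ (X l) =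
      Polynomial.C (X l) + Polynomial.C (tangent i j f l) * Polynomial.X := fun l => by simp [hΘ]
  have hΘdeg : (Θ f).natDegree ≤ f.totalDegree :=
    natDegree_aeval_le _ (fun l => by compute_degree) f
  let E : Derivation K (MvPolynomial (Fin 3) K) (MvPolynomial (Fin 3) K) :=
    pderiv j f • pderiv i - pderiv i f • pderiv j
  have hE : ∀ g, E g = pderiv j f * pderiv i g - pderiv i f * pderiv j g := fun g => rfl
  let E' : Derivation K (Polynomial (MvPolynomial (Fin 3) K)) (Polynomial (MvPolynomial (Fin 3) K)) :=
    PolynomialModule.equivPolynomialSelf.compDer E.mapCoeffs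
  have hE' : ∀ g n, (E' g).coeff n = E (g.coeff n) := fun g n => rfl
  have hEC : ∀ g, E' (Polynomial.C g) = Polynomial.C (E g) := by
    intro g
    ext1 m
    rw [hE', Polynomial.coeff_C, Polynomial.coeff_C]
    split_ifs <;> simp
  have hEX : E' Polynomial.X = 0 := by
    ext1 m
    rw [hE', Polynomial.coeff_X]
    split_ifs <;> simp
  have hEXl : ∀ l, E (X l) = tangent i j f l := by
    intro l
    rw [hE, tangent, pderiv_X, pderiv_X]
    by_cases h1 : l = i
    · subst h1
      simp [hij]
    · by_cases h2 : l = j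
      · subst h2
        simp [h1]
      · simp [h1, h2]
  have hder : Polynomial.derivative (Θ f) =
      ∑ l, Polynomial.C (tangent i j f l) * Θ (pderiv l f) := by
    have := derivation_algHom (A := Polynomial (MvPolynomial (Fin 3) K))
      (Polynomial.derivative'.restrictScalars K) Θ f
    simpa [hΘX] using this
  have hexp : E' (Θ f) = Polynomial.derivative (Θ f) + Polynomial.X *
      ∑ l, Polynomial.C (E (tangent i j f l)) * Θ (pderiv l f) := by
    rw [derivation_algHom E' Θ f, hder, Finset.mul_sum, ← Finset.sum_add_distrib]
    refine Finset.sum_congr rfl fun l _ => ?_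
    rw [hΘX, map_add, hEC, hEXl, Derivation.leibniz, hEC, hEX, smul_zero, zero_add, smul_eq_mul]
    ring
  obtain ⟨q, hq⟩ := hH
  have htan : ∀ l, pderiv i f * E (tangent i j f l) = E (pderiv i f) * tangent i j f l +
      f * (if l = i then -q else 0) := by
    intro l
    by_cases h1 : l = i
    · subst h1
      simp only [tangent, if_true]
      rw [mul_neg, ← hq, hess, hE, hE, pderiv_comm l j]
      ring
    · by_cases h2 : l = j
      · subst h2
        simp only [tangent, if_neg h1, if_true, map_neg]
        ring
      · simp [tangent, h1, h2]
  have hrel : ∀ n, ∃ w, pderiv i f * E ((Θ f).coeff n) =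
      pderiv i f * ((n + 1 : ℕ) * (Θ f).coeff (n + 1)) + E (pderiv i f) * (n * (Θ f).coeff n) +
        f * w := by
    intro n
    refine ⟨(Polynomial.X * ∑ l, Polynomial.C (if l = i then -q else 0) *
      Θ (pderiv l f)).coeff n, ?_⟩
    have h1 : Polynomial.C (pderiv i f) * E' (Θ f) =
        Polynomial.C (pderiv i f) * Polynomial.derivative (Θ f) +
        Polynomial.C (E (pderiv i f)) * (Polynomial.X * Polynomial.derivative (Θ f)) +
        Polynomial.C f * (Polynomial.X * ∑ l, Polynomial.C (if l = i then -q else 0) *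
          Θ (pderiv l f)) := by
      rw [hexp, mul_add, add_assoc]
      congr 1
      rw [hder]
      simp only [Finset.mul_sum, ← Finset.sum_add_distrib]
      refine Finset.sum_congr rfl fun l _ => ?_
      have := congrArg Polynomial.C (htan l)
      simp only [Polynomial.C_mul, Polynomial.C_add] at this
      linear_combination Polynomial.X * Θ (pderiv l f) * this
    have h2 := congrArg (fun g => Polynomial.coeff g n) h1
    simp only [Polynomial.coeff_add, Polynomial.coeff_C_mul, hE'] at h2
    rw [h2]
    congr 2
    · rw [Polynomial.coeff_derivative]
      push_cast
      ring
    · cases n with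
      | zero => simp
      | succ m =>
        rw [Polynomial.coeff_X_mul, Polynomial.coeff_derivative]
        push_cast
        ring
  have hEf : E f = 0 := by
    rw [hE]
    ring
  induction n with
  | zero =>
    have : (Θ f).coeff 0 = f := by
      rw [Polynomial.coeff_zero_eq_eval_zero]
      have : (Polynomial.evalRingHom 0).comp (Θ : MvPolynomial (Fin 3) K →+* _) =
          RingHom.id (MvPolynomial (Fin 3) K) := by
        apply MvPolynomial.ringHom_ext
        · intro r
          simp [Polynomial.algebraMap_apply, ← algebraMap_eq]
        · intro l
          simp [hΘX]
      exact DFunLike.congr_fun this f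
    rw [this]
  | succ n ih =>
    by_cases hn : f.totalDegree < n + 1
    · rw [Polynomial.coeff_eq_zero_of_natDegree_lt (hΘdeg.trans_lt hn)]
      exact dvd_zero _
    obtain ⟨w, hw⟩ := hrel n
    obtain ⟨r, hr⟩ := ih
    rw [hr, Derivation.leibniz, hEf, smul_zero, add_zero, smul_eq_mul] at hw
    have h1 : f ∣ pderiv i f * (((n + 1 : ℕ) : MvPolynomial (Fin 3) K) * (Θ f).coeff (n + 1)) :=
      ⟨pderiv i f * E r - E (pderiv i f) * n * r - w, by linear_combination -hw⟩
    have h2 := (hf.dvd_or_dvd h1).resolve_left ha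
    have hu : IsUnit (((n + 1 : ℕ) : MvPolynomial (Fin 3) K)) := by
      have h0 : ((n + 1 : ℕ) : K) ≠ 0 := by
        rw [Ne, CharP.cast_eq_zero_iff K p]
        exact fun h => absurd (Nat.le_of_dvd (Nat.succ_pos n) h) (by omega)
      have := (isUnit_iff_ne_zero.2 h0).map (algebraMap K (MvPolynomial (Fin 3) K))
      simpa using this
    exact (hu.dvd_mul_left).1 h2

/-- A surface of low degree along which the second fundamental form vanishes in the tangent
direction `(∂ⱼf) eᵢ - (∂ᵢf) eⱼ` is ruled by lines in that direction. -/
lemma lineHom_tangent_eq_zero {p : ℕ} [CharP K p] {i j : Fin 3} (hij : i ≠ j)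
    {f : MvPolynomial (Fin 3) K} (hf : Prime f) (hd : f.totalDegree < p) (hH : f ∣ hess i j f)
    (ha : ¬ f ∣ pderiv i f) {P : Fin 3 → K} (hP : eval P f = 0) :
    lineHom P (fun l => eval P (tangent i j f l)) f = 0 := by
  have h : (lineHom P (fun l => eval P (tangent i j f l)) : MvPolynomial (Fin 3) K →+* K[X]) =
      (Polynomial.mapRingHom (eval P)).comp
        (aeval (fun l => Polynomial.C (X l) + Polynomial.C (tangent i j f l) * Polynomial.X) :
          MvPolynomial (Fin 3) K →ₐ[K] Polynomial (MvPolynomial (Fin 3) K)).toRingHom := by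
    apply MvPolynomial.ringHom_ext
    · intro r
      simp [lineHom, Polynomial.algebraMap_apply, ← algebraMap_eq]
    · intro l
      simp
  have h2 := DFunLike.congr_fun h f
  refine h2.trans ?_
  ext n
  obtain ⟨q, hq⟩ := dvd_coeff_tangent_expansion hij hf hd hH ha n
  simp only [RingHom.comp_apply, AlgHom.toRingHom_eq_coe, RingHom.coe_coe,
    Polynomial.coe_mapRingHom, Polynomial.coeff_map, hq, map_mul, hP, zero_mul,
    Polynomial.coeff_zero]

lemma X_sub_C_dvd_of_retract (w : K) {f : MvPolynomial (Fin 3) K} {A : Type*} [CommRing A]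
    (φ : MvPolynomial (Fin 3) K →+* A) (ψ : A →+* MvPolynomial (Fin 3) K)
    (hC : ∀ r, ψ (φ (C r)) = C r) (hX : ∀ l ∈ f.vars, X 2 - C w ∣ X l - ψ (φ (X l)))
    (h : φ f = 0) : X 2 - C w ∣ f := by
  rw [← Ideal.mem_span_singleton, ← Ideal.Quotient.eq_zero_iff_mem]
  have : Ideal.Quotient.mk (Ideal.span {X 2 - C w}) f =
      ((Ideal.Quotient.mk (Ideal.span {X 2 - C w})).comp (ψ.comp φ)) f := by
    refine hom_congr_vars ?_ ?_ rfl
    · ext r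
      simp [hC]
    · intro l hl _
      simp only [RingHom.comp_apply]
      rw [Ideal.Quotient.eq, Ideal.mem_span_singleton]
      exact hX l hl
  rw [this]
  simp [h]

lemma not_isUnit_X_sub_C (w : K) : ¬ IsUnit (X 2 - C w : MvPolynomial (Fin 3) K) := by
  intro h
  have := h.map (eval (fun _ => w))
  simp at this

lemma dvd_X_sub_C {w : K} {f : MvPolynomial (Fin 3) K} (hf : Prime f) (h : X 2 - C w ∣ f) :
    f ∣ X 2 - C w := by
  obtain ⟨q, hq⟩ := h
  have := (hf.irreducible.isUnit_or_isUnit hq).resolve_left (not_isUnit_X_sub_C w)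
  obtain ⟨u, rfl⟩ := this
  exact ⟨↑u⁻¹, by rw [hq, mul_assoc, Units.mul_inv, mul_one]⟩

lemma dvd_pderiv_of_X_sub_C_dvd {w : K} {f : MvPolynomial (Fin 3) K} (hf : Prime f)
    (h : X 2 - C w ∣ f) : f ∣ pderiv 0 f := by
  obtain ⟨q, hq⟩ := h
  have hu := (hf.irreducible.isUnit_or_isUnit hq).resolve_left (not_isUnit_X_sub_C w)
  obtain ⟨k, -, rfl⟩ := MvPolynomial.isUnit_iff_eq_C_of_isReduced.1 hu
  rw [hq]
  simp [pderiv_X]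

/-- Restriction to the line `{(t, a t + b, c)}`, where `r = (a, b, c)`. -/
noncomputable def redHom (r : K × K × K) : MvPolynomial (Fin 3) K →ₐ[K] K[X] :=
  lineHom ![0, r.2.1, r.2.2] ![1, r.1, 0]

/-- Restriction to the line `{(t, y, n t + d)}`, where `s = (n, d, y)`. -/
noncomputable def blueHom (s : K × K × K) : MvPolynomial (Fin 3) K →ₐ[K] K[X] :=
  lineHom ![0, s.2.2, s.2.1] ![1, 0, s.1]

/-- The red line `r` and the blue line `s` meet. -/
def Meets (r s : K × K × K) : Prop := ∃ t, r.1 * t + r.2.1 = s.2.2 ∧ s.1 * t + s.2.1 = r.2.2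

lemma exists_ruling_line {p : ℕ} [CharP K p] {i j : Fin 3} (hij : i ≠ j)
    {f : MvPolynomial (Fin 3) K} (hf : Prime f) (hd : f.totalDegree < p) (hH : f ∣ hess i j f)
    (ha : ¬ f ∣ pderiv i f) {P : Fin 3 → K} (hP : eval P f = 0) (hP' : eval P (pderiv i f) ≠ 0) :
    ∃ u v : Fin 3 → K, u j = 0 ∧ v j = 1 ∧ (∀ l, l ≠ i → l ≠ j → u l = P l ∧ v l = 0) ∧
      u i + P j * v i = P i ∧ lineHom u v f = 0 := by
  have h := lineHom_tangent_eq_zero hij hf hd hH ha hP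
  set V : Fin 3 → K := fun l => eval P (tangent i j f l) with hV
  have hVj : V j = - eval P (pderiv i f) := by simp [hV, tangent, hij.symm]
  have hVj0 : V j ≠ 0 := by rwa [hVj, neg_ne_zero]
  have hV0 : ∀ l, l ≠ i → l ≠ j → V l = 0 := fun l h1 h2 => by simp [hV, tangent, h1, h2]
  refine ⟨fun l => P l + (-(P j) / V j) * V l, fun l => (V j)⁻¹ * V l, ?_, ?_, ?_, ?_, ?_⟩
  · field_simp
    ring
  · field_simp
  · intro l h1 h2
    simp [hV0 l h1 h2]
  · field_simp
    ring
  · rw [lineHom_reparam, h, Polynomial.zero_comp]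

/-- Restriction to the plane `X₂ = w`, as a polynomial in `X₀` over `K[X₁]`. -/
noncomputable def sliceHom (w : K) : MvPolynomial (Fin 3) K →ₐ[K] Polynomial K[X] :=
  aeval ![Polynomial.X, Polynomial.C Polynomial.X, Polynomial.C (Polynomial.C w)]

lemma sliceHom_ne_zero {f : MvPolynomial (Fin 3) K} (hf : Prime f) (ha : ¬ f ∣ pderiv 0 f) (w : K) :
    sliceHom w f ≠ 0 := by
  intro h0
  apply ha
  apply dvd_pderiv_of_X_sub_C_dvd (w := w) hf
  refine X_sub_C_dvd_of_retract w (sliceHom w : MvPolynomial (Fin 3) K →+* Polynomial K[X])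
    (Polynomial.eval₂RingHom (Polynomial.eval₂RingHom C (X 1)) (X 0)) ?_ ?_ h0
  · intro r
    simp [sliceHom, Polynomial.algebraMap_apply]
  · intro l _
    fin_cases l <;> simp [sliceHom]

lemma eval_sliceHom (w : K) (u v : Fin 3 → K) (hu₁ : u 1 = 0) (hv₁ : v 1 = 1) (hu₂ : u 2 = w)
    (hv₂ : v 2 = 0) (f : MvPolynomial (Fin 3) K) :
    (sliceHom w f).eval (Polynomial.C (u 0) + Polynomial.C (v 0) * Polynomial.X) =
      lineHom u v f := by
  have : (Polynomial.evalRingHom (Polynomial.C (u 0) + Polynomial.C (v 0) * Polynomial.X)).comp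
      (sliceHom w : MvPolynomial (Fin 3) K →+* Polynomial K[X]) =
      (lineHom u v : MvPolynomial (Fin 3) K →+* K[X]) := by
    apply MvPolynomial.ringHom_ext
    · intro r
      simp [sliceHom, lineHom, Polynomial.algebraMap_apply]
    · intro l
      fin_cases l <;> simp [sliceHom, hu₁, hv₁, hu₂, hv₂]
  exact DFunLike.congr_fun this f

lemma meets_of_doubly_ruled {p : ℕ} [CharP K p] [Infinite K] {f : MvPolynomial (Fin 3) K}
    (hf : Prime f) (hd : f.totalDegree < p) (h₁ : f ∣ hess 0 1 f) (h₂ : f ∣ hess 0 2 f)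
    (ha : ¬ f ∣ pderiv 0 f) {r₀ : K × K × K} (hr₀ : r₀.1 ≠ 0) (hf₀ : redHom r₀ f = 0)
    (hf₀' : redHom r₀ (pderiv 0 f) ≠ 0) {r s : K × K × K} (hr : r.1 ≠ 0) (hs : s.1 ≠ 0)
    (hrf : redHom r f = 0) (hsf : blueHom s f = 0) : Meets r s := by
  classical
  obtain ⟨a, b, c⟩ := r₀
  simp only at hr₀
  set e := f.totalDegree with he
  set q := redHom (a, b, c) (pderiv 0 f) with hq
  -- the blue lines of the surface through points of the red line
  have hline : ∀ t, q.eval t ≠ 0 → ∃ u v : Fin 3 → K, u 2 = 0 ∧ v 2 = 1 ∧ u 1 = a * t + b ∧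
      v 1 = 0 ∧ u 0 + c * v 0 = t ∧ lineHom u v f = 0 ∧
      (lineHom u v (pderiv 0 f)).eval c ≠ 0 := by
    intro t ht
    have hP : ∀ g, eval ![t, a * t + b, c] g = (redHom (a, b, c) g).eval t := by
      intro g
      rw [redHom, eval_lineHom]
      congr 1
      congr 1
      ext l
      fin_cases l <;> simp <;> ring
    obtain ⟨u, v, h1, h2, h3, h4, h5⟩ := exists_ruling_line (i := 0) (j := 2) (by decide) hf hd h₂ ha
      (P := ![t, a * t + b, c]) (by rw [hP, hf₀]; simp) (by rw [hP]; exact ht)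
    have h6 := h3 1 (by decide) (by decide)
    refine ⟨u, v, h1, h2, by simpa using h6.1, h6.2, by simpa using h4, h5, ?_⟩
    rw [eval_lineHom]
    convert ht
    rw [← hP]
    congr 1
    congr 1
    ext l
    fin_cases l
    · simpa using h4
    · simpa [h6.2] using h6.1
    · simp [h1, h2]
  choose! u v hu2 hv2 hu1 hv1 huv hL hL' using hline
  obtain ⟨T, hTsub, hTcard⟩ : ∃ T : Finset K, (∀ t ∈ T, q.eval t ≠ 0) ∧
      T.card = e * (12 * e) + 1 := by
    have hinf : Set.Infinite {t | q.eval t ≠ 0} := by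
      have := (Polynomial.finite_setOfPred_isRoot hf₀').infinite_compl
      exact this
    obtain ⟨T, hT, hc⟩ := hinf.exists_subset_card_eq (e * (12 * e) + 1)
    exact ⟨T, hT, hc⟩
  obtain ⟨w, hw⟩ : ∃ w, ((∏ t ∈ T, lineHom (u t) (v t) (pderiv 0 f)) *
      (Polynomial.X - Polynomial.C c)).eval w ≠ 0 := by
    have hne : ((∏ t ∈ T, lineHom (u t) (v t) (pderiv 0 f)) *
        (Polynomial.X - Polynomial.C c)) ≠ 0 := by
      refine mul_ne_zero (Finset.prod_ne_zero_iff.2 fun t ht h0 => ?_) (Polynomial.X_sub_C_ne_zero c)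
      exact hL' t (hTsub t ht) (by simp [h0])
    by_contra! h
    exact hne (Polynomial.funext (by simpa using h))
  rw [Polynomial.eval_mul, Polynomial.eval_prod] at hw
  have hwc : w - c ≠ 0 := by
    have := right_ne_zero_of_mul hw
    simpa using this
  have hwT : ∀ t ∈ T, (lineHom (u t) (v t) (pderiv 0 f)).eval w ≠ 0 :=
    Finset.prod_ne_zero_iff.1 (left_ne_zero_of_mul hw)
  -- the lines of the surface in the plane `X₂ = w`
  have hline2 : ∀ t ∈ T, ∃ αβ : K × K,
      αβ.2 + αβ.1 * (a * t + b) = u t 0 + v t 0 * w ∧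
      (sliceHom w f).eval (Polynomial.C αβ.2 + Polynomial.C αβ.1 * Polynomial.X) = 0 := by
    intro t ht
    have htq := hTsub t ht
    have hP : ∀ g, eval (fun l => u t l + w * v t l) g = (lineHom (u t) (v t) g).eval w :=
      fun g => (eval_lineHom _ _ _ _).symm
    obtain ⟨x, y, h1, h2, h3, h4, h5⟩ := exists_ruling_line (i := 0) (j := 1) (by decide) hf hd h₁ ha
      (P := fun l => u t l + w * v t l) (by rw [hP, hL t htq]; simp) (by rw [hP]; exact hwT t ht)
    have h6 := h3 2 (by decide) (by decide)
    refine ⟨(y 0, x 0), ?_, ?_⟩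
    · simp only [hu1 t htq, hv1 t htq] at h4
      linear_combination h4
    · rw [eval_sliceHom w x y h1 h2 _ h6.2, h5]
      rw [h6.1, hu2 t htq, hv2 t htq]
      ring
  choose! αβ hαβ hαβ' using hline2
  have hslice := sliceHom_ne_zero hf ha w
  have hcard : (sliceHom w f).roots.toFinset.card ≤ e := by
    refine (Multiset.toFinset_card_le _).trans ((Polynomial.card_roots' _).trans ?_)
    refine natDegree_aeval_le _ (fun l => ?_) f
    fin_cases l <;> simp
  obtain ⟨ρ, -, hρ⟩ := Finset.exists_lt_card_fiber_of_mul_lt_card_of_maps_to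
    (s := T) (t := (sliceHom w f).roots.toFinset) (n := 12 * e)
    (f := fun t => Polynomial.C (αβ t).2 + Polynomial.C (αβ t).1 * Polynomial.X) (by
      intro t ht
      rw [Multiset.mem_toFinset, Polynomial.mem_roots hslice]
      exact hαβ' t ht) (by
      rw [hTcard]
      exact Nat.lt_succ_of_le (Nat.mul_le_mul_right _ hcard))
  set J := T.filter fun t => Polynomial.C (αβ t).2 + Polynomial.C (αβ t).1 * Polynomial.X = ρ with hJ
  have hJne : J.Nonempty := Finset.card_pos.1 (by omega)
  obtain ⟨t₀, ht₀⟩ := hJne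
  set α := (αβ t₀).1
  set β := (αβ t₀).2
  have hJρ : ∀ t ∈ J, β + α * (a * t + b) = u t 0 + v t 0 * w := by
    intro t ht
    rw [← hαβ t (Finset.mem_filter.1 ht).1]
    have h := (Finset.mem_filter.1 ht₀).2.trans (Finset.mem_filter.1 ht).2.symm
    have := congrArg (Polynomial.eval (a * t + b)) h
    simpa using this
  let S : MvPolynomial (Fin 3) K := C (w - c) * (X 0 - C a⁻¹ * (X 1 - C b)) -
    (C β + C α * X 1 - C a⁻¹ * (X 1 - C b)) * (X 2 - C c)
  have hSdeg : S.totalDegree ≤ 2 := by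
    have hX : ∀ i, (X i : MvPolynomial (Fin 3) K).totalDegree ≤ 1 := fun i => (totalDegree_X i).le
    have hC : ∀ k, (C k : MvPolynomial (Fin 3) K).totalDegree ≤ 1 := fun k => by
      rw [totalDegree_C]
      exact zero_le_one
    have hCm : ∀ k (g : MvPolynomial (Fin 3) K), g.totalDegree ≤ 1 → (C k * g).totalDegree ≤ 1 := by
      intro k g hg
      have := totalDegree_mul (C k) g
      rw [totalDegree_C] at this
      omega
    have hsub : ∀ g h : MvPolynomial (Fin 3) K, g.totalDegree ≤ 1 → h.totalDegree ≤ 1 →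
        (g - h).totalDegree ≤ 1 := fun g h hg hh => (totalDegree_sub _ _).trans (max_le hg hh)
    have hadd : ∀ g h : MvPolynomial (Fin 3) K, g.totalDegree ≤ 1 → h.totalDegree ≤ 1 →
        (g + h).totalDegree ≤ 1 := fun g h hg hh => (totalDegree_add _ _).trans (max_le hg hh)
    have hl₁ := hCm a⁻¹ _ (hsub _ _ (hX 1) (hC b))
    have hm₁ := hsub _ _ (hadd _ _ (hC β) (hCm α _ (hX 1))) hl₁
    have hm₂ := hsub _ _ (hX 2) (hC c)
    refine (totalDegree_sub _ _).trans (max_le ?_ ((totalDegree_mul _ _).trans (add_le_add hm₁ hm₂)))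
    exact (hCm _ _ (hsub _ _ (hX 0) hl₁)).trans one_le_two
  have hfS : f ∣ S := by
    by_contra hnd
    have hJq : ∀ t ∈ J, q.eval t ≠ 0 := fun t ht => hTsub t (Finset.mem_filter.1 ht).1
    have := card_lines_le J u v 1 2 (fun t ht => hu2 t (hJq t ht)) (fun t ht => hv2 t (hJq t ht))
      (fun t ht => hv1 t (hJq t ht)) (by
        intro x hx y hy hxy
        simp only [hu1 x (hJq x hx), hu1 y (hJq y hy)] at hxy
        exact mul_left_cancel₀ hr₀ (add_right_cancel hxy)) hf hnd (fun t ht => hL t (hJq t ht)) (by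
        intro t ht
        have htq := hJq t ht
        have e1 : u t 0 = t - c * v t 0 := eq_sub_of_add_eq (huv t htq)
        have e2 := hJρ t ht
        rw [e1] at e2
        have e3 : lineHom (u t) (v t) S = Polynomial.C
          ((w - c) * v t 0 + (t - (β + α * (a * t + b)))) * (Polynomial.X - Polynomial.C c) := by
          have e4 : a⁻¹ * (a * t + b - b) = t := by field_simp; ring
          have e5 : Polynomial.C a⁻¹ * (Polynomial.C (a * t + b) - Polynomial.C b) =
              Polynomial.C t := by
            rw [← Polynomial.C_sub, ← Polynomial.C_mul, e4]
          simp only [S, map_sub, map_mul, map_add, lineHom_X, hu1 t htq, hv1 t htq, hu2 t htq,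
            hv2 t htq, e1, ← algebraMap_eq, AlgHom.commutes, ← Polynomial.C_eq_algebraMap,
            Polynomial.C_0, Polynomial.C_1] at e5 ⊢
          linear_combination (Polynomial.X - Polynomial.C w) * e5
        rw [e3, e2]
        have : (w - c) * v t 0 + (t - (t - c * v t 0 + v t 0 * w)) = 0 := by ring
        rw [this]
        simp)
    have h12 : 6 * f.totalDegree * S.totalDegree ≤ 12 * e := by
      calc 6 * f.totalDegree * S.totalDegree ≤ 6 * f.totalDegree * 2 := Nat.mul_le_mul_left _ hSdeg
        _ = 12 * e := by rw [← he]; ring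
    omega
  obtain ⟨a', b', c'⟩ := r
  obtain ⟨n, d, y⟩ := s
  simp only at hr hs
  have hS0 : ∀ φ : MvPolynomial (Fin 3) K →ₐ[K] K[X], φ f = 0 → φ S = 0 := by
    intro φ h
    obtain ⟨g, hg⟩ := hfS
    rw [hg, map_mul, h, zero_mul]
  have hred := congrArg (Polynomial.eval ((y - b') / a')) (hS0 _ hrf)
  have hblue := congrArg (Polynomial.eval ((c' - d) / n)) (hS0 _ hsf)
  rw [redHom, eval_lineHom] at hred
  rw [blueHom, eval_lineHom] at hblue
  have x1 : b' + (y - b') / a' * a' = y := by field_simp; ring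
  have x2 : d + (c' - d) / n * n = c' := by field_simp; ring
  simp [S, x1] at hred
  simp [S, x2] at hblue
  refine ⟨(y - b') / a', by simp only; field_simp; ring, ?_⟩
  have x3 : (w - c) * ((y - b') / a') = (w - c) * ((c' - d) / n) := by
    linear_combination hred - hblue
  rw [mul_left_cancel₀ hwc x3]
  simp only
  field_simp
  ring

open Classical in
/-- The number of incidences between the red lines `R` and the blue lines `B`. -/
noncomputable def inc (R B : Finset (K × K × K)) : ℕ :=
  ((R ×ˢ B).filter fun x => Meets x.1 x.2).card

open Classical in
lemma inc_eq_sum_red (R B : Finset (K × K × K)) :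
    inc R B = ∑ r ∈ R, (B.filter fun s => Meets r s).card := by
  simp only [inc, Finset.card_filter, Finset.sum_product]

open Classical in
lemma inc_eq_sum_blue (R B : Finset (K × K × K)) :
    inc R B = ∑ s ∈ B, (R.filter fun r => Meets r s).card := by
  simp only [inc, Finset.card_filter, Finset.sum_product_right]

open Classical in
lemma inc_le_of_red {R B : Finset (K × K × K)} {m : ℕ}
    (h : ∀ r ∈ R, (B.filter fun s => Meets r s).card ≤ m) : inc R B ≤ m * R.card := by
  rw [inc_eq_sum_red, mul_comm]
  exact Finset.sum_le_card_nsmul _ _ _ h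

open Classical in
lemma inc_le_of_blue {R B : Finset (K × K × K)} {m : ℕ}
    (h : ∀ s ∈ B, (R.filter fun r => Meets r s).card ≤ m) : inc R B ≤ m * B.card := by
  rw [inc_eq_sum_blue, mul_comm]
  exact Finset.sum_le_card_nsmul _ _ _ h

lemma inc_mono {R R' B B' : Finset (K × K × K)} (hR : R' ⊆ R) (hB : B' ⊆ B) :
    inc R' B' ≤ inc R B := by
  classical
  exact Finset.card_le_card (Finset.filter_subset_filter _ (Finset.product_subset_product hR hB))

lemma inc_le_mul (R B : Finset (K × K × K)) : inc R B ≤ R.card * B.card := by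
  classical
  exact (Finset.card_filter_le _ _).trans (Finset.card_product _ _).le

open Classical in
lemma inc_union_red {R R' B : Finset (K × K × K)} (h : Disjoint R R') :
    inc (R ∪ R') B = inc R B + inc R' B := by
  simp only [inc_eq_sum_red, Finset.sum_union h]

open Classical in
lemma inc_union_blue {R B B' : Finset (K × K × K)} (h : Disjoint B B') :
    inc R (B ∪ B') = inc R B + inc R B' := by
  simp only [inc_eq_sum_blue, Finset.sum_union h]

open Classical in
/-- Red and blue lines in general position, any two of the blue lines having at most `k` common red
transversals. -/
structure Config (R B : Finset (K × K × K)) (k : ℕ) : Prop where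
  red_ne : ∀ r ∈ R, r.1 ≠ 0
  blue_ne : ∀ s ∈ B, s.1 ≠ 0
  red_inj : Set.InjOn (fun r : K × K × K => r.2.2) R
  blue_inj : Set.InjOn (fun s : K × K × K => s.2.2) B
  common : ∀ s ∈ B, ∀ s' ∈ B, s ≠ s' → (R.filter fun r => Meets r s ∧ Meets r s').card ≤ k

lemma Config.mono {R R' B B' : Finset (K × K × K)} {k : ℕ} (h : Config R B k) (hR : R' ⊆ R)
    (hB : B' ⊆ B) : Config R' B' k where
  red_ne r hr := h.red_ne r (hR hr)
  blue_ne s hs := h.blue_ne s (hB hs)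
  red_inj := h.red_inj.mono hR
  blue_inj := h.blue_inj.mono hB
  common s hs s' hs' hne := by
    classical
    exact (Finset.card_le_card (Finset.filter_subset_filter _ hR)).trans
      (h.common s (hB hs) s' (hB hs') hne)

lemma eval_redHom_eq {r s : K × K × K} {t : K} (h₁ : r.1 * t + r.2.1 = s.2.2)
    (h₂ : s.1 * t + s.2.1 = r.2.2) (f : MvPolynomial (Fin 3) K) :
    (redHom r f).eval t = (blueHom s f).eval t := by
  rw [redHom, blueHom, eval_lineHom, eval_lineHom]
  congr 1
  congr 1
  ext l
  fin_cases l
  · simp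
  · simp [← h₁]
    ring
  · simp [← h₂]
    ring

open Classical in
lemma card_meets_red_le {r : K × K × K} {B : Finset (K × K × K)} {f : MvPolynomial (Fin 3) K}
    (hB : Set.InjOn (fun s : K × K × K => s.2.2) B) (hr : redHom r f ≠ 0)
    (hf : ∀ s ∈ B, blueHom s f = 0) : (B.filter fun s => Meets r s).card ≤ f.totalDegree := by
  have h : ∀ s ∈ B.filter fun s => Meets r s,
      ∃ t, r.1 * t + r.2.1 = s.2.2 ∧ s.1 * t + s.2.1 = r.2.2 :=
    fun s hs => (Finset.mem_filter.1 hs).2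
  choose! t ht₁ ht₂ using h
  refine le_trans ?_ ((Polynomial.card_roots' (redHom r f)).trans (natDegree_lineHom_le _ _ f))
  refine le_trans ?_ (Multiset.toFinset_card_le _)
  refine Finset.card_le_card_of_injOn t ?_ ?_
  · intro s hs
    rw [Finset.mem_coe, Multiset.mem_toFinset, Polynomial.mem_roots hr, Polynomial.IsRoot.def,
      eval_redHom_eq (ht₁ s hs) (ht₂ s hs), hf s (Finset.mem_filter.1 hs).1, Polynomial.eval_zero]
  · intro s hs s' hs' h
    refine hB (Finset.mem_filter.1 hs).1 (Finset.mem_filter.1 hs').1 ?_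
    simp only
    rw [← ht₁ s hs, ← ht₁ s' hs', h]

open Classical in
lemma card_meets_blue_le {s : K × K × K} {R : Finset (K × K × K)} {f : MvPolynomial (Fin 3) K}
    (hR : Set.InjOn (fun r : K × K × K => r.2.2) R) (hs : blueHom s f ≠ 0)
    (hf : ∀ r ∈ R, redHom r f = 0) : (R.filter fun r => Meets r s).card ≤ f.totalDegree := by
  have h : ∀ r ∈ R.filter fun r => Meets r s,
      ∃ t, r.1 * t + r.2.1 = s.2.2 ∧ s.1 * t + s.2.1 = r.2.2 :=
    fun r hr => (Finset.mem_filter.1 hr).2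
  choose! t ht₁ ht₂ using h
  refine le_trans ?_ ((Polynomial.card_roots' (blueHom s f)).trans (natDegree_lineHom_le _ _ f))
  refine le_trans ?_ (Multiset.toFinset_card_le _)
  refine Finset.card_le_card_of_injOn t ?_ ?_
  · intro r hr
    rw [Finset.mem_coe, Multiset.mem_toFinset, Polynomial.mem_roots hs, Polynomial.IsRoot.def,
      ← eval_redHom_eq (ht₁ r hr) (ht₂ r hr), hf r (Finset.mem_filter.1 hr).1, Polynomial.eval_zero]
  · intro r hr r' hr' h
    refine hR (Finset.mem_filter.1 hr).1 (Finset.mem_filter.1 hr').1 ?_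
    simp only
    rw [← ht₂ r hr, ← ht₂ r' hr', h]

lemma card_red_le {R : Finset (K × K × K)} (hR : Set.InjOn (fun r : K × K × K => r.2.2) R)
    {f g : MvPolynomial (Fin 3) K} (hf : Prime f) (hfg : ¬ f ∣ g) (h₁ : ∀ r ∈ R, redHom r f = 0)
    (h₂ : ∀ r ∈ R, redHom r g = 0) : R.card ≤ 6 * f.totalDegree * g.totalDegree :=
  card_lines_le R (fun r => ![0, r.2.1, r.2.2]) (fun r => ![1, r.1, 0]) 2 0 (by simp) (by simp)
    (by simp) hR hf hfg h₁ h₂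

lemma totalDegree_pos_of_prime {f : MvPolynomial (Fin 3) K} (hf : Prime f) :
    0 < f.totalDegree := by
  rw [Nat.pos_iff_ne_zero]
  intro h
  rw [totalDegree_eq_zero_iff_eq_C] at h
  have h0 : coeff 0 f ≠ 0 := fun h' => hf.ne_zero (by rw [h, h', C_0])
  apply hf.not_isUnit
  rw [h]
  exact (isUnit_iff_ne_zero.2 h0).map C

lemma X_sub_C_dvd_of_red {p : ℕ} [CharP K p] {f : MvPolynomial (Fin 3) K}
    (hd : f.totalDegree < p) (h : pderiv 0 f = 0) {r : K × K × K} (hr : r.1 ≠ 0)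
    (hrf : redHom r f = 0) : X 2 - C r.2.2 ∣ f := by
  have h0 := notMem_vars_of_pderiv_eq_zero hd h
  refine X_sub_C_dvd_of_retract r.2.2 (redHom r : MvPolynomial (Fin 3) K →+* K[X])
    (Polynomial.eval₂RingHom C (C r.1⁻¹ * (X 1 - C r.2.1))) ?_ ?_ hrf
  · intro x
    simp [redHom, lineHom]
  · intro l hl
    have hC : (C r.1 * C r.1⁻¹ : MvPolynomial (Fin 3) K) = 1 := by
      rw [← C_mul, mul_inv_cancel₀ hr, C_1]
    fin_cases l
    · exact absurd hl h0
    · refine ⟨0, ?_⟩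
      simp [redHom]
      linear_combination -(X 1 - C r.2.1) * hC
    · simp [redHom]

lemma incidences_on_prime_surface {p : ℕ} [CharP K p] [Infinite K] {R B : Finset (K × K × K)}
    {k : ℕ} (hRB : Config R B k) {f : MvPolynomial (Fin 3) K} (hf : Prime f)
    (hd : f.totalDegree < p) (hR : ∀ r ∈ R, redHom r f = 0) (hB : ∀ s ∈ B, blueHom s f = 0) :
    (∃ R' ⊆ R, R'.card ≤ 54 * f.totalDegree ^ 2 ∧
      inc R B ≤ inc R' B + 3 * f.totalDegree * R.card) ∨
    inc R B ≤ 3 * f.totalDegree * R.card + k * B.card := by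
  classical
  have hpos := totalDegree_pos_of_prime hf
  by_cases h₂ : f ∣ hess 0 2 f
  swap
  · left
    refine ⟨R.filter fun r => redHom r (hess 0 2 f) = 0, Finset.filter_subset _ _, ?_, ?_⟩
    · have := card_red_le (R := R.filter fun r => redHom r (hess 0 2 f) = 0)
        (hRB.red_inj.mono (Finset.filter_subset _ _)) hf h₂
        (fun r hr => hR r (Finset.mem_filter.1 hr).1) (fun r hr => (Finset.mem_filter.1 hr).2)
      have h3 := totalDegree_hess_le 0 2 f
      nlinarith
    · have h1 := inc_union_red (B := B) (Finset.disjoint_filter_filter_not R R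
        (fun r => redHom r (hess 0 2 f) = 0))
      rw [Finset.filter_union_filter_not_eq] at h1
      rw [h1]
      gcongr
      refine (inc_le_of_red (m := 3 * f.totalDegree) fun r hr => ?_).trans
        (Nat.mul_le_mul_left _ (Finset.card_filter_le _ _))
      refine (card_meets_red_le hRB.blue_inj (Finset.mem_filter.1 hr).2 fun s hs => ?_).trans
        (totalDegree_hess_le 0 2 f)
      refine lineHom_hess (by decide) (by simp) (fun l h1 h2 => ?_) (hB s hs)
      fin_cases l <;> simp_all
  by_cases h₁ : f ∣ hess 0 1 f
  swap
  · left
    refine ⟨R, subset_rfl, ?_, Nat.le_add_right _ _⟩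
    have := card_red_le hRB.red_inj hf h₁ hR (fun r hr => by
      refine lineHom_hess (by decide) (by simp) (fun l h1 h2 => ?_) (hR r hr)
      fin_cases l <;> simp_all)
    have h3 := totalDegree_hess_le 0 1 f
    nlinarith
  by_cases h0 : pderiv 0 f = 0
  · left
    refine ⟨R, subset_rfl, ?_, Nat.le_add_right _ _⟩
    have h1 : R.card ≤ 1 := by
      rw [Finset.card_le_one]
      intro r hr r' hr'
      refine hRB.red_inj hr hr' ?_
      by_contra hne
      have e1 := dvd_X_sub_C hf (X_sub_C_dvd_of_red hd h0 (hRB.red_ne r hr) (hR r hr))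
      have e2 := dvd_X_sub_C hf (X_sub_C_dvd_of_red hd h0 (hRB.red_ne r' hr') (hR r' hr'))
      have e3 := dvd_sub e2 e1
      have e4 : (X 2 - C r'.2.2 - (X 2 - C r.2.2) : MvPolynomial (Fin 3) K) =
          C (r.2.2 - r'.2.2) := by
        rw [C_sub]
        ring
      rw [e4] at e3
      exact hf.not_isUnit (isUnit_of_dvd_unit e3 ((isUnit_iff_ne_zero.2 (sub_ne_zero.2 hne)).map C))
    nlinarith
  have ha := not_dvd_pderiv h0
  by_cases hred : ∀ r ∈ R, redHom r (pderiv 0 f) = 0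
  · left
    refine ⟨R, subset_rfl, ?_, Nat.le_add_right _ _⟩
    have := card_red_le hRB.red_inj hf ha hR hred
    have h3 := totalDegree_pderiv_le 0 f
    nlinarith
  push Not at hred
  obtain ⟨r₀, hr₀, hr₀'⟩ := hred
  right
  have hmeet : ∀ r ∈ R, ∀ s ∈ B, Meets r s := fun r hr s hs =>
    meets_of_doubly_ruled hf hd h₁ h₂ ha (hRB.red_ne r₀ hr₀) (hR r₀ hr₀) hr₀'
      (hRB.red_ne r hr) (hRB.blue_ne s hs) (hR r hr) (hB s hs)
  have hmul := inc_le_mul R B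
  by_cases hB1 : B.card ≤ 1
  · nlinarith
  · obtain ⟨s, hs, s', hs', hne⟩ := Finset.one_lt_card.1 (not_le.1 hB1)
    have h1 := hRB.common s hs s' hs' hne
    rw [Finset.filter_true_of_mem fun r hr => ⟨hmeet r hr s hs, hmeet r hr s' hs'⟩] at h1
    nlinarith

lemma incidences_on_surface {p : ℕ} [CharP K p] [Infinite K] {k : ℕ}
    (f : MvPolynomial (Fin 3) K) : f ≠ 0 → f.totalDegree < p →
    ∀ R B : Finset (K × K × K), Config R B k → (∀ r ∈ R, redHom r f = 0) →
      (∀ s ∈ B, blueHom s f = 0) → ∃ R' ⊆ R, ∃ B' ⊆ B, R'.card ≤ 54 * f.totalDegree ^ 2 ∧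
        inc R B + k * B'.card ≤ inc R' B' + 4 * f.totalDegree * (R.card + B.card) + k * B.card := by
  classical
  induction f using UniqueFactorizationMonoid.induction_on_prime with
  | h₁ => exact fun h => absurd rfl h
  | h₂ f hf =>
    intro _ _ R B _ hR hB
    have h1 : R = ∅ := Finset.eq_empty_of_forall_notMem fun r hr =>
      (hf.map (redHom r)).ne_zero (hR r hr)
    refine ⟨∅, by simp, ∅, by simp, by simp, ?_⟩
    simp [h1, inc]
  | h₃ F G hF hG ih =>
    intro hne hd R B hRB hR hB
    rw [totalDegree_mul_of_isDomain hG.ne_zero hF] at hd ⊢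
    set e := G.totalDegree
    set d := F.totalDegree
    set R₁ := R.filter fun r => redHom r G = 0
    set R₂ := R.filter fun r => ¬ redHom r G = 0
    set B₁ := B.filter fun s => blueHom s G = 0
    set B₂ := B.filter fun s => ¬ blueHom s G = 0
    have sR₁ : R₁ ⊆ R := Finset.filter_subset _ _
    have sR₂ : R₂ ⊆ R := Finset.filter_subset _ _
    have sB₁ : B₁ ⊆ B := Finset.filter_subset _ _
    have sB₂ : B₂ ⊆ B := Finset.filter_subset _ _
    have uR : R₁ ∪ R₂ = R := Finset.filter_union_filter_not_eq _ _
    have uB : B₁ ∪ B₂ = B := Finset.filter_union_filter_not_eq _ _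
    have dR : Disjoint R₁ R₂ := Finset.disjoint_filter_filter_not _ _ _
    have dB : Disjoint B₁ B₂ := Finset.disjoint_filter_filter_not _ _ _
    have cR : R.card = R₁.card + R₂.card := by rw [← Finset.card_union_of_disjoint dR, uR]
    have cB : B.card = B₁.card + B₂.card := by rw [← Finset.card_union_of_disjoint dB, uB]
    have hinc : inc R B = inc R₁ B₁ + inc R₁ B₂ + (inc R₂ B₁ + inc R₂ B₂) := by
      rw [← inc_union_blue dB, ← inc_union_blue dB, uB, ← inc_union_red dR, uR]
    have h21 : inc R₂ B₁ ≤ e * R₂.card := inc_le_of_red fun r hr =>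
      card_meets_red_le (hRB.blue_inj.mono sB₁) (Finset.mem_filter.1 hr).2
        fun s hs => (Finset.mem_filter.1 hs).2
    have h12 : inc R₁ B₂ ≤ e * B₂.card := inc_le_of_blue fun s hs =>
      card_meets_blue_le (hRB.red_inj.mono sR₁) (Finset.mem_filter.1 hs).2
        fun r hr => (Finset.mem_filter.1 hr).2
    obtain ⟨R', hR', B', hB', hc, h22⟩ := ih hF (by omega) R₂ B₂ (hRB.mono sR₂ sB₂)
      (fun r hr => by
        have h := hR r (sR₂ hr)
        rw [map_mul, mul_eq_zero] at h
        exact h.resolve_left (Finset.mem_filter.1 hr).2)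
      (fun s hs => by
        have h := hB s (sB₂ hs)
        rw [map_mul, mul_eq_zero] at h
        exact h.resolve_left (Finset.mem_filter.1 hs).2)
    rcases incidences_on_prime_surface (hRB.mono sR₁ sB₁) hG (by omega)
      (fun r hr => (Finset.mem_filter.1 hr).2) (fun s hs => (Finset.mem_filter.1 hs).2) with
      ⟨R'', hR'', hc', h11⟩ | h11
    · refine ⟨R'' ∪ R', Finset.union_subset (hR''.trans sR₁) (hR'.trans sR₂), B₁ ∪ B',
        Finset.union_subset sB₁ (hB'.trans sB₂), ?_, ?_⟩
      · refine (Finset.card_union_le _ _).trans ?_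
        nlinarith
      · have h1 : inc R'' B₁ + inc R' B' ≤ inc (R'' ∪ R') (B₁ ∪ B') := by
          rw [inc_union_red (dR.mono hR'' hR')]
          exact add_le_add (inc_mono subset_rfl Finset.subset_union_left)
            (inc_mono subset_rfl Finset.subset_union_right)
        rw [Finset.card_union_of_disjoint (dB.mono_right hB'), cB, cR]
        nlinarith
    · refine ⟨R', hR'.trans sR₂, B', hB'.trans sB₂, ?_, ?_⟩
      · nlinarith
      · rw [cB, cR, hinc]
        nlinarith

lemma exists_reduction {p : ℕ} [CharP K p] [Infinite K] {k m : ℕ} {R B : Finset (K × K × K)}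
    (h : Config R B k) (hm : B.card ≤ m) (hm0 : 0 < m) (hmp : 27 * m < p ^ 2) :
    ∃ d : ℕ, d ^ 2 ≤ 27 * m ∧ ∃ R' ⊆ R, ∃ B' ⊆ B, R'.card ≤ 54 * d ^ 2 ∧
      inc R B + k * B'.card ≤ inc R' B' + 5 * d * (R.card + B.card) + k * B.card := by
  classical
  have hD1 : 3 * m < (Nat.sqrt (3 * m) + 1) ^ 2 := Nat.lt_succ_sqrt' _
  have hD2 : Nat.sqrt (3 * m) ^ 2 ≤ 3 * m := Nat.sqrt_le' _
  set D := Nat.sqrt (3 * m)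
  obtain ⟨f, hf, hfd, hB⟩ := exists_vanishing B (fun s => ![0, s.2.2, s.2.1])
    (fun s => ![1, 0, s.1]) D (by
      have h1 : B.card * (3 * D + 1) ≤ m * (3 * D + 1) := Nat.mul_le_mul_right _ hm
      have h2 : 3 * m * (3 * D + 1) < (D + 1) ^ 2 * (3 * D + 1) :=
        Nat.mul_lt_mul_of_pos_right hD1 (by omega)
      nlinarith)
  have hB' : ∀ s ∈ B, blueHom s f = 0 := hB
  have hd2 : f.totalDegree ^ 2 ≤ 27 * m := by nlinarith
  have hdp : f.totalDegree < p := lt_of_pow_lt_pow_left₀ 2 (Nat.zero_le _) (hd2.trans_lt hmp)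
  set R₁ := R.filter fun r => redHom r f = 0
  set R₂ := R.filter fun r => ¬ redHom r f = 0
  have uR : R₁ ∪ R₂ = R := Finset.filter_union_filter_not_eq _ _
  have dR : Disjoint R₁ R₂ := Finset.disjoint_filter_filter_not _ _ _
  have cR : R.card = R₁.card + R₂.card := by rw [← Finset.card_union_of_disjoint dR, uR]
  have hinc : inc R B = inc R₁ B + inc R₂ B := by rw [← inc_union_red dR, uR]
  have h2 : inc R₂ B ≤ f.totalDegree * R₂.card := inc_le_of_red fun r hr =>
    card_meets_red_le h.blue_inj (Finset.mem_filter.1 hr).2 hB'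
  obtain ⟨R', hR', B', hB'', hc, h1⟩ := incidences_on_surface f hf hdp R₁ B
    (h.mono (Finset.filter_subset _ _) subset_rfl) (fun r hr => (Finset.mem_filter.1 hr).2) hB'
  refine ⟨f.totalDegree, hd2, R', hR'.trans (Finset.filter_subset _ _), B', hB'', hc, ?_⟩
  rw [hinc, cR]
  nlinarith

lemma inc_le_of_pieces {R B : Finset (K × K × K)} {m : ℕ} {X k : ℝ}
    (h : ∀ B' ⊆ B, B'.card ≤ m → (inc R B' : ℝ) ≤ X + k * B'.card) (j : ℕ) :
    ∀ B' ⊆ B, B'.card ≤ j * m → (inc R B' : ℝ) ≤ j * X + k * B'.card := by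
  classical
  induction j with
  | zero =>
    intro B' _ hc
    have : B' = ∅ := by simpa using hc
    simp [this, inc]
  | succ j ih =>
    intro B' hB' hc
    obtain ⟨T, hT, hTc⟩ := Finset.exists_subset_card_eq (min_le_right m B'.card)
    have h1 := h T (hT.trans hB') (by omega)
    have h3 : (B' \ T).card = B'.card - min m B'.card := by
      rw [Finset.card_sdiff_of_subset hT, hTc]
    have h2 := ih (B' \ T) (Finset.sdiff_subset.trans hB') (by
      rw [h3]
      rw [add_mul] at hc
      omega)
    have h4 := inc_union_blue (R := R) (Finset.disjoint_sdiff (s := T) (t := B'))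
    rw [Finset.union_sdiff_of_subset hT] at h4
    have h5 : (B'.card : ℝ) = T.card + (B' \ T).card := by
      rw [← Nat.cast_add, h3, hTc]
      congr 1
      omega
    rw [h4, h5]
    push_cast
    linarith

theorem inc_le {p : ℕ} [CharP K p] [Infinite K] {k : ℕ} (n : ℕ) :
    ∀ R B : Finset (K × K × K), Config R B k → R.card + B.card = n → n ≤ 2 * p ^ 2 →
      (inc R B : ℝ) ≤ 10 ^ 8 * n * √n + k * B.card := by
  induction n using Nat.strong_induction_on with
  | _ n ih =>
  intro R B hRB hn hp
  have hs0 : 0 ≤ √(n : ℝ) := Real.sqrt_nonneg _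
  have hsq : √(n : ℝ) ^ 2 = n := Real.sq_sqrt (Nat.cast_nonneg _)
  have hn0 : (0 : ℝ) ≤ n := Nat.cast_nonneg _
  by_cases hq : n ≤ 4 * 2918 ^ 3
  · have h1 : (inc R B : ℝ) ≤ n * n := by
      have := inc_le_mul R B
      have h2 : inc R B ≤ n * n := this.trans (Nat.mul_le_mul (by omega) (by omega))
      exact_mod_cast h2
    have h2 : √(n : ℝ) ≤ 10 ^ 8 := by
      rw [Real.sqrt_le_left (by norm_num)]
      have : (n : ℝ) ≤ 4 * 2918 ^ 3 := by exact_mod_cast hq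
      exact this.trans (by norm_num)
    have h3 : (0 : ℝ) ≤ k * B.card := by positivity
    have h4 : (n : ℝ) * √n * √n ≤ n * √n * 10 ^ 8 := by gcongr
    nlinarith
  push Not at hq
  obtain ⟨m, hmdef⟩ : ∃ m, m = n / (4 * 2918 ^ 3) + 1 := ⟨_, rfl⟩
  have hm1 : n ≤ (4 * 2918 ^ 3) * m := by
    rw [hmdef]
    omega
  have hm2 : (4 * 2918 ^ 3) * m ≤ 2 * n := by
    rw [hmdef]
    omega
  have hm2' : (4 * 2918 ^ 3) * (m : ℝ) ≤ 2 * n := by exact_mod_cast hm2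
  have hX := inc_le_of_pieces (R := R) (B := B) (m := m) (k := k)
    (X := 10 ^ 8 * (n * √n) / (8 * 2918 ^ 3) + (n * √n) / 8000) ?_ (4 * 2918 ^ 3) B subset_rfl
    (by omega)
  · refine hX.trans ?_
    have : 0 ≤ n * √(n : ℝ) := by positivity
    push_cast
    nlinarith
  intro B₁ hB₁ hc
  obtain ⟨d, hd, R', hR', B', hB', hc', h1⟩ := exists_reduction (hRB.mono subset_rfl hB₁) hc
    (by omega) (by omega : 27 * m < p ^ 2)
  have hB'c := Finset.card_le_card hB'
  have hB₁c := Finset.card_le_card hB₁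
  have hn' : R'.card + B'.card ≤ 1459 * m := by omega
  have h2 := ih (R'.card + B'.card) (by omega) R' B' (hRB.mono hR' (hB'.trans hB₁)) rfl (by omega)
  set n' := R'.card + B'.card
  have hn'' : (n' : ℝ) ≤ n / (2 * 2918) ^ 2 := by
    have : (n' : ℝ) ≤ 1459 * m := by exact_mod_cast hn'
    rw [le_div_iff₀ (by norm_num)]
    nlinarith
  have h3 : √(n' : ℝ) ≤ √n / (2 * 2918) := by
    rw [Real.sqrt_le_left (by positivity), div_pow, hsq]
    exact hn''
  have h4 : 10 ^ 8 * (n' : ℝ) * √n' ≤ 10 ^ 8 * (n * √n) / (8 * 2918 ^ 3) := by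
    calc 10 ^ 8 * (n' : ℝ) * √n' ≤ 10 ^ 8 * (n / (2 * 2918) ^ 2) * (√n / (2 * 2918)) := by gcongr
      _ = _ := by ring
  have h5 : (d : ℝ) ≤ √n / 40000 := by
    refine abs_le_of_sq_le_sq' ?_ (by positivity) |>.2
    rw [div_pow, hsq]
    have : (d : ℝ) ^ 2 ≤ 27 * m := by exact_mod_cast hd
    rw [le_div_iff₀ (by norm_num)]
    nlinarith
  have h6 : (5 : ℝ) * d * (R.card + B₁.card) ≤ n * √n / 8000 := by
    have : (R.card + B₁.card : ℝ) ≤ n := by exact_mod_cast (by omega : R.card + B₁.card ≤ n)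
    calc (5 : ℝ) * d * (R.card + B₁.card) ≤ 5 * (√n / 40000) * n := by gcongr
      _ = _ := by ring
  have h1' : (inc R B₁ : ℝ) + k * B'.card ≤
      inc R' B' + 5 * d * (R.card + B₁.card) + k * B₁.card := by exact_mod_cast h1
  linarith

/-- The point `x` of affine space lies on the plane with coordinates `y`. -/
def Inc (x y : K × K × K) : Prop := x.1 * y.1 + x.2.1 * y.2.1 + x.2.2 + y.2.2 = 0

/-- The red line attached to a point, over the function field. -/
noncomputable def redOf (x : K × K × K) :
    FractionRing K[X] × FractionRing K[X] × FractionRing K[X] :=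
  (algebraMap K[X] _ (.C x.1 + .X ^ 2), algebraMap K[X] _ (.C x.2.1),
    algebraMap K[X] _ (.C x.2.2 + .C x.2.1 * .X + .X ^ 4) /
      algebraMap K[X] _ (.C x.1 + .X ^ 2))

/-- The blue line attached to a plane, over the function field. -/
noncomputable def blueOf (y : K × K × K) :
    FractionRing K[X] × FractionRing K[X] × FractionRing K[X] :=
  (algebraMap K[X] _ (.C y.2.1 - .X), -algebraMap K[X] _ (.C y.1),
    -algebraMap K[X] _ (.C y.2.2 - .C y.1 * .X ^ 2 - .X ^ 4) /
      algebraMap K[X] _ (.C y.2.1 - .X))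

lemma redOf_ne (x : K × K × K) : (redOf x).1 ≠ 0 := by
  rw [redOf, Ne, map_eq_zero_iff _ (IsFractionRing.injective K[X] (FractionRing K[X])), add_comm]
  exact (Polynomial.monic_X_pow_add_C _ two_ne_zero).ne_zero

lemma blueOf_ne (y : K × K × K) : (blueOf y).1 ≠ 0 := by
  rw [blueOf, Ne, map_eq_zero_iff _ (IsFractionRing.injective K[X] (FractionRing K[X])), ← neg_sub,
    neg_eq_zero]
  exact Polynomial.X_sub_C_ne_zero _

lemma coeffs_eq_zero {a₀ a₁ a₂ a₃ a₄ : K}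
    (h : (.C a₀ + .C a₁ * .X + .C a₂ * .X ^ 2 + .C a₃ * .X ^ 3 + .C a₄ * .X ^ 4 : K[X]) = 0) :
    a₀ = 0 ∧ a₁ = 0 ∧ a₂ = 0 ∧ a₃ = 0 ∧ a₄ = 0 := by
  refine ⟨?_, ?_, ?_, ?_, ?_⟩
  · simpa [Polynomial.coeff_X_pow, Polynomial.coeff_C] using congrArg (Polynomial.coeff · 0) h
  · simpa [Polynomial.coeff_X_pow, Polynomial.coeff_C] using congrArg (Polynomial.coeff · 1) h
  · simpa [Polynomial.coeff_X, Polynomial.coeff_X_pow, Polynomial.coeff_C] using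
      congrArg (Polynomial.coeff · 2) h
  · simpa [Polynomial.coeff_X, Polynomial.coeff_X_pow, Polynomial.coeff_C] using
      congrArg (Polynomial.coeff · 3) h
  · simpa [Polynomial.coeff_X, Polynomial.coeff_X_pow, Polynomial.coeff_C] using
      congrArg (Polynomial.coeff · 4) h

lemma redOf_injective : Function.Injective fun x : K × K × K => (redOf x).2.2 := by
  intro x x' h
  simp only [redOf] at h
  have h1 := redOf_ne x
  have h2 := redOf_ne x'
  simp only [redOf] at h1 h2
  rw [div_eq_div_iff h1 h2, ← map_mul, ← map_mul] at h
  have h3 := IsFractionRing.injective K[X] (FractionRing K[X]) h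
  obtain ⟨-, -, e2, e3, e4⟩ := coeffs_eq_zero (a₀ := x.2.2 * x'.1 - x'.2.2 * x.1)
    (a₁ := x.2.1 * x'.1 - x'.2.1 * x.1) (a₂ := x.2.2 - x'.2.2) (a₃ := x.2.1 - x'.2.1)
    (a₄ := x'.1 - x.1) (by
      simp only [map_sub, map_mul]
      linear_combination h3)
  exact Prod.ext (sub_eq_zero.1 e4).symm (Prod.ext (sub_eq_zero.1 e3) (sub_eq_zero.1 e2))

lemma blueOf_injective : Function.Injective fun y : K × K × K => (blueOf y).2.2 := by
  intro x x' h
  simp only [blueOf] at h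
  have h1 := blueOf_ne x
  have h2 := blueOf_ne x'
  simp only [blueOf] at h1 h2
  rw [div_eq_div_iff h1 h2, ← map_neg, ← map_neg, ← map_mul, ← map_mul] at h
  have h3 := IsFractionRing.injective K[X] (FractionRing K[X]) h
  obtain ⟨-, e1, -, e3, e4⟩ := coeffs_eq_zero (a₀ := x.2.2 * x'.2.1 - x'.2.2 * x.2.1)
    (a₁ := x'.2.2 - x.2.2) (a₂ := x'.1 * x.2.1 - x.1 * x'.2.1) (a₃ := x.1 - x'.1)
    (a₄ := x.2.1 - x'.2.1) (by
      simp only [map_sub, map_mul]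
      linear_combination -h3)
  exact Prod.ext (sub_eq_zero.1 e3) (Prod.ext (sub_eq_zero.1 e4) (sub_eq_zero.1 e1).symm)

lemma meets_redOf_blueOf (x y : K × K × K) : Meets (redOf x) (blueOf y) ↔ Inc x y := by
  have hr := redOf_ne x
  have hb := blueOf_ne y
  have h1 : (redOf x).1 * (redOf x).2.2 =
      algebraMap K[X] _ (.C x.2.2 + .C x.2.1 * .X + .X ^ 4) := mul_div_cancel₀ _ hr
  have h2 : (blueOf y).1 * (blueOf y).2.2 =
      -algebraMap K[X] _ (.C y.2.2 - .C y.1 * .X ^ 2 - .X ^ 4) := mul_div_cancel₀ _ hb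
  have h3 : Meets (redOf x) (blueOf y) ↔
      (blueOf y).1 * ((blueOf y).2.2 - (redOf x).2.1) =
        (redOf x).1 * ((redOf x).2.2 - (blueOf y).2.1) := by
    constructor
    · rintro ⟨t, ht₁, ht₂⟩
      rw [← ht₁, ← ht₂]
      ring
    · intro h
      refine ⟨((blueOf y).2.2 - (redOf x).2.1) / (redOf x).1, ?_, ?_⟩
      · field_simp
        ring
      · field_simp
        linear_combination h
  rw [h3, mul_sub, mul_sub, h1, h2, ← sub_eq_zero, Inc]
  have h4 : -algebraMap K[X] (FractionRing K[X]) (.C y.2.2 - .C y.1 * .X ^ 2 - .X ^ 4) -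
      (blueOf y).1 * (redOf x).2.1 - (algebraMap K[X] _ (.C x.2.2 + .C x.2.1 * .X + .X ^ 4) -
        (redOf x).1 * (blueOf y).2.1) =
      -algebraMap K[X] _ (.C (x.1 * y.1 + x.2.1 * y.2.1 + x.2.2 + y.2.2)) := by
    simp only [redOf, blueOf, map_add, map_sub, map_mul, map_pow]
    ring
  rw [h4, neg_eq_zero, map_eq_zero_iff _ (IsFractionRing.injective K[X] (FractionRing K[X])),
    Polynomial.C_eq_zero]

open Classical in
/-- Rudnev's point-plane incidence bound. -/
theorem card_incidences_le {p : ℕ} [CharP K p] (P Q : Finset (K × K × K)) (k : ℕ)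
    (hk : ∀ y ∈ Q, ∀ y' ∈ Q, y ≠ y' → (P.filter fun x => Inc x y ∧ Inc x y').card ≤ k)
    (hc : P.card + Q.card ≤ 2 * p ^ 2) :
    (((P ×ˢ Q).filter fun z => Inc z.1 z.2).card : ℝ) ≤
      10 ^ 8 * (P.card + Q.card : ℕ) * √((P.card + Q.card : ℕ) : ℝ) + k * Q.card := by
  have : CharP (FractionRing K[X]) p :=
    charP_of_injective_algebraMap (IsFractionRing.injective K[X] (FractionRing K[X])) p
  have : Infinite (FractionRing K[X]) :=
    Infinite.of_injective _ (IsFractionRing.injective K[X] (FractionRing K[X]))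
  have hr : Function.Injective (redOf (K := K)) := fun x x' h =>
    redOf_injective (congrArg (·.2.2) h)
  have hb : Function.Injective (blueOf (K := K)) := fun x x' h =>
    blueOf_injective (congrArg (·.2.2) h)
  have hconf : Config (P.image redOf) (Q.image blueOf) k := by
    refine ⟨?_, ?_, ?_, ?_, ?_⟩
    · simp only [Finset.forall_mem_image]
      exact fun x _ => redOf_ne x
    · simp only [Finset.forall_mem_image]
      exact fun x _ => blueOf_ne x
    · rw [Finset.coe_image]
      rintro _ ⟨x, _, rfl⟩ _ ⟨x', _, rfl⟩ h
      exact congrArg redOf (redOf_injective h)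
    · rw [Finset.coe_image]
      rintro _ ⟨y, _, rfl⟩ _ ⟨y', _, rfl⟩ h
      exact congrArg blueOf (blueOf_injective h)
    · simp only [Finset.forall_mem_image]
      intro y hy y' hy' hne
      rw [Finset.filter_image, Finset.card_image_of_injective _ hr]
      simp only [meets_redOf_blueOf]
      exact hk y hy y' hy' fun h => hne (by rw [h])
  have h1 := inc_le (p := p) (P.card + Q.card) _ _ hconf (by
    rw [Finset.card_image_of_injective _ hr, Finset.card_image_of_injective _ hb]) hc
  rw [Finset.card_image_of_injective _ hb] at h1
  convert h1 using 2
  rw [inc_eq_sum_red, Finset.sum_image hr.injOn]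
  simp only [Finset.card_filter, Finset.sum_product, Finset.sum_image hb.injOn,
    meets_redOf_blueOf]

end PointPlane

section Correlation
variable {G : Type*} [CommGroup G] [Fintype G]

/-- The multiplicative autocorrelation of `f`. -/
def corr (f : G → ℝ) (y : G) : ℝ := ∑ d, f d * f (y * d)

/-- The bilinear form with kernel `corr f (d / e)`. -/
def corrForm (f v w : G → ℝ) : ℝ := ∑ d, ∑ e, v d * w e * corr f (d / e)

/-- The correlation of `v` with `f`. -/
def transfer (f v : G → ℝ) (x : G) : ℝ := ∑ e, v e * f (e * x)

lemma corr_nonneg {f : G → ℝ} (hf : 0 ≤ f) (y : G) : 0 ≤ corr f y :=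
  Finset.sum_nonneg fun d _ => mul_nonneg (hf d) (hf _)

lemma sum_div_eq (Φ : G → G → ℝ) : ∑ e, ∑ d, Φ e d = ∑ y, ∑ d, Φ (y * d) d := by
  rw [Finset.sum_comm, Finset.sum_comm (f := fun y d => Φ (y * d) d)]
  exact Finset.sum_congr rfl fun d _ => (Equiv.sum_comp (Equiv.mulRight d) (Φ · d)).symm

lemma sum_mul_shift (f : G → ℝ) (e e' : G) : ∑ x, f (e * x) * f (e' * x) = corr f (e / e') := by
  rw [corr, ← Equiv.sum_comp (Equiv.mulLeft e') (fun d => f d * f (e / e' * d))]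
  refine Finset.sum_congr rfl fun x _ => ?_
  simp only [Equiv.coe_mulLeft]
  rw [← mul_assoc, div_mul_cancel, mul_comm]

lemma corr_inv (f : G → ℝ) (y : G) : corr f y⁻¹ = corr f y := by
  have h1 := sum_mul_shift f 1 y
  have h2 := sum_mul_shift f y 1
  rw [one_div] at h1
  rw [div_one] at h2
  rw [← h1, ← h2]
  exact Finset.sum_congr rfl fun x _ => mul_comm _ _

lemma sum_transfer_mul (f v w : G → ℝ) :
    ∑ x, transfer f v x * transfer f w x = corrForm f v w := by
  simp only [transfer, corrForm, ← sum_mul_shift]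
  simp only [Finset.sum_mul_sum]
  rw [Finset.sum_comm]
  refine Finset.sum_congr rfl fun e _ => ?_
  rw [Finset.sum_comm]
  refine Finset.sum_congr rfl fun e' _ => ?_
  rw [Finset.mul_sum]
  exact Finset.sum_congr rfl fun x _ => by ring

lemma corrForm_self_nonneg (f v : G → ℝ) : 0 ≤ corrForm f v v := by
  rw [← sum_transfer_mul]
  exact Finset.sum_nonneg fun x _ => mul_self_nonneg _

lemma corrForm_mono {f v w : G → ℝ} (hf : 0 ≤ f) (hv : 0 ≤ v) (h : v ≤ w) :
    corrForm f v v ≤ corrForm f w w := by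
  refine Finset.sum_le_sum fun e _ => Finset.sum_le_sum fun d _ => ?_
  have := corr_nonneg hf (e / d)
  have h1 := hv d
  have h2 := (hv e).trans (h e)
  gcongr
  · exact h e
  · exact h d

/-- Convexity of the quadratic form. -/
lemma corrForm_sum_le {ι : Type*} (I : Finset ι) (f : G → ℝ) (c : ι → ℝ) (u : ι → G → ℝ)
    (hc : ∀ i ∈ I, 0 ≤ c i) :
    corrForm f (fun e => ∑ i ∈ I, c i * u i e) (fun e => ∑ i ∈ I, c i * u i e) ≤
      (∑ i ∈ I, c i) * ∑ i ∈ I, c i * corrForm f (u i) (u i) := by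
  simp only [← sum_transfer_mul, Finset.mul_sum (s := Finset.univ)]
  rw [Finset.sum_comm, Finset.mul_sum]
  refine Finset.sum_le_sum fun x _ => ?_
  have h : transfer f (fun e => ∑ i ∈ I, c i * u i e) x = ∑ i ∈ I, c i * transfer f (u i) x := by
    simp only [transfer, Finset.sum_mul, Finset.mul_sum]
    rw [Finset.sum_comm]
    exact Finset.sum_congr rfl fun i _ => Finset.sum_congr rfl fun e _ => by ring
  rw [h, ← sq]
  refine Finset.sum_sq_le_sum_mul_sum_of_sq_le_mul I hc
    (fun i hi => mul_nonneg (hc i hi) (mul_self_nonneg _)) fun i _ => le_of_eq (by ring)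

lemma sum_mul_div_eq (f h : G → ℝ) : ∑ e, f e * ∑ d, h (e / d) * f d = ∑ y, h y * corr f y := by
  simp only [Finset.mul_sum, corr]
  rw [sum_div_eq]
  refine Finset.sum_congr rfl fun y _ => Finset.sum_congr rfl fun d _ => ?_
  rw [mul_div_cancel_right]
  ring

lemma corrForm_self (f : G → ℝ) : corrForm f f f = ∑ y, corr f y ^ 2 := by
  simp only [sq, ← sum_mul_div_eq, corrForm, Finset.mul_sum]
  exact Finset.sum_congr rfl fun y _ => Finset.sum_congr rfl fun d _ => by ring

/-- The sum over triples with given ratios. -/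
def triple (f : G → ℝ) (r z : G) : ℝ := ∑ d, f d * (f (z * d) * f (r * z * d))

lemma sum_triple_sq (f : G → ℝ) : ∑ r, ∑ z, triple f r z ^ 2 = ∑ y, corr f y ^ 3 := by
  have h1 : ∑ r, ∑ z, triple f r z ^ 2 =
      ∑ w, ∑ z, (∑ d, f d * (f (z * d) * f (w * d))) ^ 2 := by
    rw [sum_div_eq (fun w z => (∑ d, f d * (f (z * d) * f (w * d))) ^ 2)]
    rfl
  have h2 : ∑ y, corr f y ^ 3 = ∑ e, ∑ d, f e * f d * corr f (e / d) ^ 2 := by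
    rw [sum_div_eq]
    refine Finset.sum_congr rfl fun y _ => ?_
    simp only [mul_div_cancel_right]
    rw [← Finset.sum_mul, pow_succ', corr]
    simp only [mul_comm]
  rw [h1, h2]
  simp only [sq, Finset.sum_mul_sum, ← sum_mul_shift]
  simp only [Finset.mul_sum]
  have h3 : ∀ Φ : G → G → G → G → ℝ, ∑ w, ∑ z, ∑ d, ∑ e, Φ w z d e =
      ∑ d, ∑ e, ∑ w, ∑ z, Φ w z d e := by
    intro Φ
    simp only [← Fintype.sum_prod_type']
    let eq : G × G × G × G ≃ G × G × G × G :=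
      ⟨fun x => (x.2.2.1, x.2.2.2, x.1, x.2.1), fun x => (x.2.2.1, x.2.2.2, x.1, x.2.1),
        fun _ => rfl, fun _ => rfl⟩
    exact Equiv.sum_comp eq fun x => Φ x.2.2.1 x.2.2.2 x.1 x.2.1
  rw [h3]
  refine Finset.sum_congr rfl fun d _ => Finset.sum_congr rfl fun e _ =>
    Finset.sum_congr rfl fun w _ => Finset.sum_congr rfl fun z _ => ?_
  simp only [mul_comm]
  ring

end Correlation

lemma sum_truncate_ge {ι : Type*} [Fintype ι] (g : ι → ℝ) (hg : 0 ≤ g) (hD : 0 < ∑ y, g y ^ 2) :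
    ∑ y, g y ^ 2 ≤ 2 * ∑ y,
      (if g y ≤ 2 * (∑ y, g y ^ 3) / ∑ y, g y ^ 2 then g y else 0) * g y := by
  set D := ∑ y, g y ^ 2
  set T := ∑ y, g y ^ 3
  have h1 : ∑ y, (g y ^ 2 - (if g y ≤ 2 * T / D then g y else 0) * g y) ≤
      ∑ y, D / (2 * T) * g y ^ 3 := by
    refine Finset.sum_le_sum fun y _ => ?_
    have hT : 0 ≤ T := Finset.sum_nonneg fun y _ => pow_nonneg (hg y) 3
    have hgy := hg y
    split_ifs with hy
    · have : 0 ≤ D / (2 * T) * g y ^ 3 := by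
        have := pow_nonneg hgy 3
        positivity
      nlinarith
    · push Not at hy
      have hg0 : 0 < g y := lt_of_le_of_lt (by positivity) hy
      have hT0 : 0 < T := lt_of_lt_of_le (pow_pos hg0 3)
        (Finset.single_le_sum (f := fun y => g y ^ 3) (fun y _ => pow_nonneg (hg y) 3)
          (Finset.mem_univ y))
      rw [div_lt_iff₀ hD] at hy
      rw [div_mul_eq_mul_div, le_div_iff₀ (by positivity)]
      nlinarith [pow_pos hg0 2]
  rw [Finset.sum_sub_distrib, ← Finset.mul_sum] at h1
  have h2 : D / (2 * T) * T ≤ D / 2 := by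
    by_cases hT : T = 0
    · rw [hT]
      simp
      positivity
    · apply le_of_eq
      field_simp
  change D - _ ≤ D / (2 * T) * T at h1
  linarith

section Correlation
variable {G : Type*} [CommGroup G] [Fintype G]

lemma corrForm_mul_self_le {f h : G → ℝ} (hf : 0 ≤ f) (hh : 0 ≤ h) (hle : h ≤ corr f) :
    (∑ y, h y * corr f y) ^ 4 ≤ (∑ d, f d) ^ 2 * (∑ y, corr f y ^ 2) *
      corrForm f (fun e => f e * ∑ d, h (e / d) * f d) (fun e => f e * ∑ d, h (e / d) * f d) := by
  set A : G → ℝ := fun e => ∑ d, h (e / d) * f d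
  set v : G → ℝ := fun e => f e * A e
  have hA : 0 ≤ A := fun e => Finset.sum_nonneg fun d _ => mul_nonneg (hh _) (hf d)
  have h1 : (∑ y, h y * corr f y) ^ 2 ≤ (∑ d, f d) * ∑ e, f e * A e ^ 2 := by
    rw [← sum_mul_div_eq]
    exact Finset.sum_sq_le_sum_mul_sum_of_sq_le_mul _ (fun i _ => hf i)
      (fun i _ => mul_nonneg (hf i) (sq_nonneg _)) fun i _ => le_of_eq (by ring)
  have h2 : ∑ e, f e * A e ^ 2 ≤ corrForm f v f := by
    refine Finset.sum_le_sum fun e _ => ?_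
    have : f e * A e ^ 2 = ∑ e', v e * f e' * h (e / e') := by
      have h4 : f e * A e ^ 2 = v e * ∑ e', h (e / e') * f e' := by
        change f e * A e ^ 2 = f e * A e * A e
        ring
      rw [h4, Finset.mul_sum]
      exact Finset.sum_congr rfl fun d _ => by ring
    rw [this]
    refine Finset.sum_le_sum fun e' _ => ?_
    exact mul_le_mul_of_nonneg_left (hle _) (mul_nonneg (mul_nonneg (hf e) (hA e)) (hf e'))
  have h3 : corrForm f v f ^ 2 ≤ corrForm f v v * ∑ y, corr f y ^ 2 := by
    rw [← corrForm_self, ← sum_transfer_mul, ← sum_transfer_mul, ← sum_transfer_mul]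
    simp only [← sq]
    exact Finset.sum_mul_sq_le_sq_mul_sq _ _ _
  have h0 : 0 ≤ ∑ e, f e * A e ^ 2 :=
    Finset.sum_nonneg fun e _ => mul_nonneg (hf e) (sq_nonneg _)
  calc (∑ y, h y * corr f y) ^ 4 = ((∑ y, h y * corr f y) ^ 2) ^ 2 := by ring
    _ ≤ ((∑ d, f d) * ∑ e, f e * A e ^ 2) ^ 2 := by gcongr
    _ = (∑ d, f d) ^ 2 * (∑ e, f e * A e ^ 2) ^ 2 := by ring
    _ ≤ (∑ d, f d) ^ 2 * (corrForm f v f) ^ 2 := by gcongr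
    _ ≤ (∑ d, f d) ^ 2 * (corrForm f v v * ∑ y, corr f y ^ 2) := by gcongr
    _ = _ := by ring

lemma sum_corrForm_eq (f h : G → ℝ) :
    ∑ d, f d * corrForm f (fun e => f e * h (e / d)) (fun e => f e * h (e / d)) =
      ∑ r, ∑ z, triple f r z * (corr f r * (h z * h (r * z))) := by
  have h1 : ∀ d, corrForm f (fun e => f e * h (e / d)) (fun e => f e * h (e / d)) =
      ∑ z, ∑ r, f (z * d) * f (r * z * d) * (corr f r * (h z * h (r * z))) := by
    intro d
    rw [corrForm, sum_div_eq, Finset.sum_comm, ← Equiv.sum_comp (Equiv.mulRight d)]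
    refine Finset.sum_congr rfl fun z _ => Finset.sum_congr rfl fun r _ => ?_
    simp only [Equiv.coe_mulRight, mul_div_cancel_right, ← mul_assoc]
    rw [mul_assoc r z d, mul_div_cancel_right]
    ring
  simp only [h1, triple, Finset.sum_mul, Finset.mul_sum]
  rw [Finset.sum_comm' (s := Finset.univ) (t := fun _ => Finset.univ) (t' := Finset.univ)
    (s' := fun _ => Finset.univ) (by simp)]
  rw [Finset.sum_comm (f := fun r z => ∑ d, f d * (f (z * d) * f (r * z * d)) *
    (corr f r * (h z * h (r * z))))]
  refine Finset.sum_congr rfl fun z _ => ?_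
  rw [Finset.sum_comm]
  exact Finset.sum_congr rfl fun r _ => Finset.sum_congr rfl fun d _ => by ring

lemma sum_triple_mul_sq_le {f h : G → ℝ} {Γ : ℝ} (hf : 0 ≤ f) (hh : 0 ≤ h) (hle : h ≤ corr f)
    (hΓ : ∀ y, h y ≤ Γ) :
    (∑ r, ∑ z, triple f r z * (corr f r * (h z * h (r * z)))) ^ 2 ≤
      Γ * (∑ y, corr f y ^ 3) *
        corrForm f (fun y => corr f y ^ 2) (fun y => corr f y ^ 2) := by
  have hΓ0 : 0 ≤ Γ := (hh 1).trans (hΓ 1)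
  have h1 : (∑ r, ∑ z, triple f r z * (corr f r * (h z * h (r * z)))) ^ 2 ≤
      (∑ r, ∑ z, triple f r z ^ 2 * h (r * z)) *
        ∑ r, ∑ z, corr f r ^ 2 * h z ^ 2 * h (r * z) := by
    simp only [← Fintype.sum_prod_type']
    refine Finset.sum_sq_le_sum_mul_sum_of_sq_le_mul _
      (fun i _ => mul_nonneg (sq_nonneg _) (hh _))
      (fun i _ => mul_nonneg (mul_nonneg (sq_nonneg _) (sq_nonneg _)) (hh _))
      fun i _ => le_of_eq (by ring)
  have h2 : ∑ r, ∑ z, triple f r z ^ 2 * h (r * z) ≤ Γ * ∑ y, corr f y ^ 3 := by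
    rw [← sum_triple_sq, Finset.mul_sum]
    refine Finset.sum_le_sum fun r _ => ?_
    rw [Finset.mul_sum]
    refine Finset.sum_le_sum fun z _ => ?_
    rw [mul_comm]
    exact mul_le_mul_of_nonneg_right (hΓ _) (sq_nonneg _)
  have h3 : ∑ r, ∑ z, corr f r ^ 2 * h z ^ 2 * h (r * z) ≤
      corrForm f (fun y => corr f y ^ 2) (fun y => corr f y ^ 2) := by
    refine Finset.sum_le_sum fun r _ => ?_
    rw [← Equiv.sum_comp (Equiv.inv G)]
    refine Finset.sum_le_sum fun z _ => ?_
    simp only [Equiv.inv_apply, ← div_eq_mul_inv]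
    have h4 : h z⁻¹ ^ 2 ≤ corr f z ^ 2 := by
      rw [← corr_inv f z]
      exact pow_le_pow_left₀ (hh _) (hle _) 2
    exact mul_le_mul (mul_le_mul_of_nonneg_left h4 (sq_nonneg _)) (hle _) (hh _) (by positivity)
  refine h1.trans (mul_le_mul h2 h3 ?_ ?_)
  · exact Finset.sum_nonneg fun r _ => Finset.sum_nonneg fun z _ =>
      mul_nonneg (mul_nonneg (sq_nonneg _) (sq_nonneg _)) (hh _)
  · exact mul_nonneg hΓ0 (Finset.sum_nonneg fun y _ => pow_nonneg (corr_nonneg hf y) 3)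

theorem sum_corr_sq_pow_seven_le {f : G → ℝ} (hf : 0 ≤ f) :
    (∑ y, corr f y ^ 2) ^ 7 ≤ 512 * (∑ d, f d) ^ 6 * (∑ y, corr f y ^ 3) ^ 2 *
      corrForm f (fun y => corr f y ^ 2) (fun y => corr f y ^ 2) := by
  have hS : 0 ≤ ∑ d, f d := Finset.sum_nonneg fun d _ => hf d
  have hW := corrForm_self_nonneg f (fun y => corr f y ^ 2)
  have hT : 0 ≤ ∑ y, corr f y ^ 3 := Finset.sum_nonneg fun y _ => pow_nonneg (corr_nonneg hf y) 3
  rcases (Finset.sum_nonneg fun y _ => sq_nonneg _ : 0 ≤ ∑ y, corr f y ^ 2).eq_or_lt with hD | hD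
  · rw [← hD, zero_pow (by norm_num)]
    exact mul_nonneg (by positivity) hW
  have htr := sum_truncate_ge (corr f) (corr_nonneg hf) hD
  set D := ∑ y, corr f y ^ 2 with hDdef
  set T := ∑ y, corr f y ^ 3
  set S := ∑ d, f d with hSdef
  set W := corrForm f (fun y => corr f y ^ 2) (fun y => corr f y ^ 2)
  set h : G → ℝ := fun y => if corr f y ≤ 2 * T / D then corr f y else 0 with hdef
  have hh : 0 ≤ h := by
    intro y
    simp only [hdef]
    split_ifs
    exacts [corr_nonneg hf y, le_rfl]
  have hle : h ≤ corr f := by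
    intro y
    simp only [hdef]
    split_ifs
    exacts [le_rfl, corr_nonneg hf y]
  have hΓ : ∀ y, h y ≤ 2 * T / D := by
    intro y
    simp only [hdef]
    split_ifs with hy
    exacts [hy, by positivity]
  have h4 := corrForm_mul_self_le hf hh hle
  have h5 := corrForm_sum_le Finset.univ f f (fun d e => f e * h (e / d)) fun d _ => hf d
  have h6 := sum_triple_mul_sq_le hf hh hle hΓ
  rw [sum_corrForm_eq] at h5
  rw [← hDdef, ← hSdef] at h4
  set Z := ∑ r, ∑ z, triple f r z * (corr f r * (h z * h (r * z)))
  have hv : (fun e => ∑ d, f d * (f e * h (e / d))) = fun e => f e * ∑ d, h (e / d) * f d := by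
    ext e
    rw [Finset.mul_sum]
    exact Finset.sum_congr rfl fun d _ => by ring
  rw [hv, ← hSdef] at h5
  set q := corrForm f (fun e => f e * ∑ d, h (e / d) * f d) (fun e => f e * ∑ d, h (e / d) * f d)
  have h7 : D ^ 4 ≤ 16 * (S ^ 3 * D * Z) := by
    calc D ^ 4 ≤ (2 * ∑ y, h y * corr f y) ^ 4 := pow_le_pow_left₀ hD.le htr 4
      _ = 16 * (∑ y, h y * corr f y) ^ 4 := by ring
      _ ≤ 16 * (S ^ 2 * D * q) := by gcongr
      _ ≤ 16 * (S ^ 2 * D * (S * Z)) := by gcongr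
      _ = _ := by ring
  have h8 : D ^ 3 ≤ 16 * S ^ 3 * Z := by
    refine le_of_mul_le_mul_right ?_ hD
    linarith
  have h9 : (D ^ 3) ^ 2 ≤ 256 * S ^ 6 * (2 * T / D * T * W) := by
    calc (D ^ 3) ^ 2 ≤ (16 * S ^ 3 * Z) ^ 2 := pow_le_pow_left₀ (by positivity) h8 2
      _ = 256 * S ^ 6 * Z ^ 2 := by ring
      _ ≤ _ := by gcongr
  calc D ^ 7 = (D ^ 3) ^ 2 * D := by ring
    _ ≤ 256 * S ^ 6 * (2 * T / D * T * W) * D := by gcongr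
    _ = _ := by
      field_simp
      ring

end Correlation

section Dyadic
variable {G : Type*} [CommGroup G] [Fintype G]

lemma corrForm_smul (f u : G → ℝ) (a : ℝ) :
    corrForm f (fun e => a * u e) (fun e => a * u e) = a ^ 2 * corrForm f u u := by
  simp only [corrForm, Finset.mul_sum]
  exact Finset.sum_congr rfl fun e _ => Finset.sum_congr rfl fun e' _ => by ring

open Classical in
lemma corrForm_sq_le {f : G → ℝ} (hf : 0 ≤ f) {K : ℕ} (h1 : ∀ y, corr f y = 0 ∨ 1 ≤ corr f y)
    (hK : ∀ y, corr f y < 2 ^ K) {a b : ℝ} (ha : 0 ≤ a) (hb : 0 ≤ b)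
    (h : ∀ V : Finset G, corrForm f (fun e => if e ∈ V then 1 else 0)
      (fun e => if e ∈ V then 1 else 0) ≤ a * (V.card * √V.card) + b * V.card ^ 2) :
    corrForm f (fun y => corr f y ^ 2) (fun y => corr f y ^ 2) ≤
      16 * K ^ 2 * (a * (√(∑ y, corr f y ^ 2) * ∑ y, corr f y ^ 3) +
        b * (∑ y, corr f y ^ 2) ^ 2) := by
  set g := corr f
  have hg : 0 ≤ g := corr_nonneg hf
  set V : ℕ → Finset G := fun i => Finset.univ.filter fun y => 2 ^ i ≤ g y ∧ g y < 2 ^ (i + 1)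
  have hle : (fun y => g y ^ 2) ≤
      fun y => ∑ i ∈ Finset.range K, 1 * (4 ^ (i + 1) * if y ∈ V i then (1 : ℝ) else 0) := by
    intro y
    simp only [one_mul]
    have hpos : ∀ i ∈ Finset.range K, (0 : ℝ) ≤ 4 ^ (i + 1) * if y ∈ V i then (1 : ℝ) else 0 :=
      fun i _ => by split_ifs <;> positivity
    rcases h1 y with h0 | h0
    · rw [h0]
      simpa using Finset.sum_nonneg hpos
    · obtain ⟨i, hi₁, hi₂⟩ := exists_nat_pow_near h0 (one_lt_two (α := ℝ))
      have hi : i < K := (pow_lt_pow_iff_right₀ (one_lt_two (α := ℝ))).1 (hi₁.trans_lt (hK y))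
      refine le_trans ?_ (Finset.single_le_sum hpos (Finset.mem_range.2 hi))
      have hy : y ∈ V i := by simp [V, hi₁, hi₂]
      rw [if_pos hy, mul_one]
      calc g y ^ 2 ≤ (2 ^ (i + 1)) ^ 2 := pow_le_pow_left₀ (hg y) hi₂.le 2
        _ = 4 ^ (i + 1) := by
          rw [← pow_mul, mul_comm, pow_mul]
          norm_num
  refine (corrForm_mono hf (fun y => sq_nonneg _) hle).trans ?_
  refine (corrForm_sum_le (Finset.range K) f (fun _ => 1)
    (fun i y => 4 ^ (i + 1) * if y ∈ V i then (1 : ℝ) else 0) fun _ _ => zero_le_one).trans ?_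
  have hterm : ∀ i ∈ Finset.range K, (1 : ℝ) *
      corrForm f (fun y => 4 ^ (i + 1) * if y ∈ V i then (1 : ℝ) else 0)
        (fun y => 4 ^ (i + 1) * if y ∈ V i then (1 : ℝ) else 0) ≤
      16 * (a * (√(∑ y, g y ^ 2) * ∑ y, g y ^ 3) + b * (∑ y, g y ^ 2) ^ 2) := by
    intro i _
    rw [corrForm_smul, one_mul]
    have hpow : ∀ n : ℕ, ((V i).card : ℝ) * (2 ^ i) ^ n ≤ ∑ y, g y ^ n := by
      intro n
      rw [← nsmul_eq_mul]
      refine (Finset.card_nsmul_le_sum (V i) (fun y => g y ^ n) _ fun y hy => ?_).trans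
        (Finset.sum_le_sum_of_subset_of_nonneg (Finset.subset_univ _)
          fun y _ _ => pow_nonneg (hg y) n)
      exact pow_le_pow_left₀ (by positivity) (Finset.mem_filter.1 hy).2.1 n
    have h2 := hpow 2
    have h3 := hpow 3
    have h4 : √((V i).card : ℝ) * 2 ^ i ≤ √(∑ y, g y ^ 2) := by
      apply Real.le_sqrt_of_sq_le
      rw [mul_pow, Real.sq_sqrt (Nat.cast_nonneg _)]
      exact h2
    have h5 : ((4 : ℝ) ^ (i + 1)) ^ 2 = 16 * (2 ^ i) ^ 4 := by
      rw [← pow_mul, ← pow_mul, show (16 : ℝ) = 2 ^ 4 by norm_num, ← pow_add,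
        show (4 : ℝ) = 2 ^ 2 by norm_num, ← pow_mul]
      congr 1
      ring
    rw [h5]
    calc 16 * ((2 : ℝ) ^ i) ^ 4 * corrForm f (fun y => if y ∈ V i then (1 : ℝ) else 0)
          (fun y => if y ∈ V i then (1 : ℝ) else 0)
        ≤ 16 * ((2 : ℝ) ^ i) ^ 4 * (a * ((V i).card * √(V i).card) + b * (V i).card ^ 2) := by
          gcongr
          exact h (V i)
      _ = 16 * (a * ((√(V i).card * 2 ^ i) * ((V i).card * (2 ^ i) ^ 3)) +
            b * ((V i).card * (2 ^ i) ^ 2) ^ 2) := by ring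
      _ ≤ _ := by gcongr
  have hsum := Finset.sum_le_sum hterm
  rw [Finset.sum_const, Finset.card_range, nsmul_eq_mul] at hsum
  rw [Finset.sum_const, Finset.card_range, nsmul_eq_mul, mul_one]
  calc (K : ℝ) * _ ≤ K * _ := mul_le_mul_of_nonneg_left hsum (Nat.cast_nonneg _)
    _ = _ := by ring

end Dyadic

section Applications
variable {F : Type*} [Field F]

lemma card_le_of_incidences {p : ℕ} [CharP F p] {ι κ τ : Type*} (s : Finset ι) (t : Finset κ)
    (x : ι → F × F × F) (y : κ → F × F × F) (hx : Set.InjOn x s) (hy : Set.InjOn y t) {n k : ℕ}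
    (hs : s.card = n) (ht : t.card = n) (hn : n ≤ p ^ 2)
    (hk : ∀ j ∈ t, ∀ j' ∈ t, j ≠ j' → ∀ U ⊆ s,
      (∀ i ∈ U, Inc (x i) (y j) ∧ Inc (x i) (y j')) → U.card ≤ k)
    (T : Finset τ) (α : τ → ι) (β : τ → κ) (hα : ∀ z ∈ T, α z ∈ s) (hβ : ∀ z ∈ T, β z ∈ t)
    (hinj : Set.InjOn (fun z => (α z, β z)) T) (hT : ∀ z ∈ T, Inc (x (α z)) (y (β z))) :
    (T.card : ℝ) ≤ 3 * 10 ^ 8 * (n * √n) + k * n := by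
  classical
  have h1 := card_incidences_le (p := p) (s.image x) (t.image y) k ?_ (by
    rw [Finset.card_image_of_injOn hx, Finset.card_image_of_injOn hy, hs, ht]
    omega)
  · rw [Finset.card_image_of_injOn hx, Finset.card_image_of_injOn hy, hs, ht] at h1
    have h2 : (T.card : ℝ) ≤ (((s.image x) ×ˢ (t.image y)).filter fun z => Inc z.1 z.2).card := by
      refine Nat.cast_le.2 (Finset.card_le_card_of_injOn (fun z => (x (α z), y (β z))) ?_ ?_)
      · intro z hz
        rw [Finset.mem_coe, Finset.mem_filter, Finset.mem_product]
        exact ⟨⟨Finset.mem_image_of_mem x (hα z hz), Finset.mem_image_of_mem y (hβ z hz)⟩, hT z hz⟩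
      · intro z hz z' hz' h
        rw [Prod.mk.injEq] at h
        exact hinj hz hz' (Prod.ext (hx (hα z hz) (hα z' hz') h.1) (hy (hβ z hz) (hβ z' hz') h.2))
    refine h2.trans (h1.trans ?_)
    have h3 : √((n + n : ℕ) : ℝ) ≤ 3 / 2 * √n := by
      rw [Real.sqrt_le_left (by positivity), mul_pow, Real.sq_sqrt (Nat.cast_nonneg _)]
      push_cast
      linarith [(Nat.cast_nonneg n : (0 : ℝ) ≤ n)]
    have h4 : 10 ^ 8 * ((n + n : ℕ) : ℝ) * √((n + n : ℕ) : ℝ) ≤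
        10 ^ 8 * ((n + n : ℕ) : ℝ) * (3 / 2 * √n) := by gcongr
    push_cast at h4 ⊢
    linarith
  · simp only [Finset.forall_mem_image]
    intro j hj j' hj' hne
    rw [Finset.filter_image]
    refine Finset.card_image_le.trans (hk j hj j' hj' (fun h => hne (by rw [h])) _
      (Finset.filter_subset _ _) fun i hi => (Finset.mem_filter.1 hi).2)

open Classical in
/-- The number of representations of `u` as a difference of elements of `C`. -/
noncomputable def diffs (C : Finset F) (u : Fˣ) : ℝ :=
  ((C ×ˢ C).filter fun x => x.1 - x.2 = (u : F)).card

variable [Fintype Fˣ]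

open Classical in
lemma corrForm_diffs_le {p : ℕ} [CharP F p] (C : Finset F) (V : Finset Fˣ)
    (h : C.card ^ 2 * V.card ≤ p ^ 2) :
    corrForm (diffs C) (fun e => if e ∈ V then 1 else 0) (fun e => if e ∈ V then 1 else 0) ≤
      4 * 10 ^ 8 * C.card ^ 3 * (V.card * √V.card) + C.card ^ 2 * V.card ^ 2 := by
  set S : Finset (Fˣ × F × F) := V ×ˢ C ×ˢ C
  set P : Fˣ → Finset (Fˣ × F × F) := fun u => S.filter fun x => x.2.1 - x.2.2 = x.1 * u
  set T : Finset ((Fˣ × F × F) × (Fˣ × F × F)) := Finset.univ.biUnion fun u => P u ×ˢ P u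
  have hS : S.card = C.card ^ 2 * V.card := by
    simp only [S, Finset.card_product]
    ring
  have h1 : corrForm (diffs C) (fun e => if e ∈ V then 1 else 0) (fun e => if e ∈ V then 1 else 0) =
      T.card := by
    rw [← sum_transfer_mul, Finset.card_biUnion, Nat.cast_sum]
    · refine Finset.sum_congr rfl fun u _ => ?_
      have : transfer (diffs C) (fun e => if e ∈ V then 1 else 0) u = (P u).card := by
        simp only [transfer, diffs, P, S, Finset.card_filter, Finset.sum_product, ite_mul, one_mul,
          zero_mul, Finset.sum_ite_mem, Finset.univ_inter, Units.val_mul, Nat.cast_sum]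
      rw [this, Finset.card_product, Nat.cast_mul]
    · intro u _ u' _ hne
      rw [Function.onFun, Finset.disjoint_left]
      intro z hz hz'
      have e1 := (Finset.mem_filter.1 (Finset.mem_product.1 hz).1).2
      have e2 := (Finset.mem_filter.1 (Finset.mem_product.1 hz').1).2
      rw [e1] at e2
      exact hne (Units.ext (mul_left_cancel₀ z.1.1.ne_zero e2))
  have hmem : ∀ z ∈ T, (z.1 ∈ S ∧ z.2 ∈ S) ∧
      z.1.1 * (z.2.2.1 - z.2.2.2) = z.2.1 * (z.1.2.1 - z.1.2.2) := by
    intro z hz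
    obtain ⟨u, -, hu⟩ := Finset.mem_biUnion.1 hz
    obtain ⟨hu₁, hu₂⟩ := Finset.mem_product.1 hu
    obtain ⟨hu₁, e1⟩ := Finset.mem_filter.1 hu₁
    obtain ⟨hu₂, e2⟩ := Finset.mem_filter.1 hu₂
    refine ⟨⟨hu₁, hu₂⟩, ?_⟩
    rw [e1, e2]
    ring
  have hSm : ∀ {z : Fˣ × F × F}, z ∈ S ↔ z.1 ∈ V ∧ z.2.1 ∈ C ∧ z.2.2 ∈ C := by
    intro z
    simp only [S, Finset.mem_product]
  have h2 := card_le_of_incidences (p := p) S S (fun z => ((z.1 : F), z.2.1, -(z.1 * z.2.2)))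
    (fun z => (z.2.1, -(z.1 : F), z.1 * z.2.2)) ?_ ?_ hS hS h (k := V.card + C.card) ?_ T
    (fun z => (z.2.1, z.2.2.1, z.1.2.2)) (fun z => (z.1.1, z.1.2.1, z.2.2.2))
    (fun z hz => by
      have := (hmem z hz).1
      rw [hSm, hSm] at this
      exact hSm.2 ⟨this.2.1, this.2.2.1, this.1.2.2⟩)
    (fun z hz => by
      have := (hmem z hz).1
      rw [hSm, hSm] at this
      exact hSm.2 ⟨this.1.1, this.1.2.1, this.2.2.2⟩)
    (by
      rintro ⟨⟨r, a, b⟩, z, c, d⟩ _ ⟨⟨r', a', b'⟩, z', c', d'⟩ _ h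
      simp only [Prod.mk.injEq] at h ⊢
      tauto)
    (fun z hz => by
      have := (hmem z hz).2
      simp only [Inc]
      linear_combination -this)
  · rw [h1]
    refine h2.trans ?_
    push_cast
    have h3 : √((C.card : ℝ) ^ 2 * V.card) = C.card * √V.card := by
      rw [Real.sqrt_mul (by positivity), Real.sqrt_sq (by positivity)]
    have h4 : (V.card : ℝ) ≤ V.card * √V.card := by
      rcases Nat.eq_zero_or_pos V.card with h0 | h0
      · simp [h0]
      · refine le_mul_of_one_le_right (by positivity) (Real.one_le_sqrt.2 ?_)
        exact_mod_cast h0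
    rw [h3]
    have h5 : (C.card : ℝ) ^ 3 * V.card ≤ C.card ^ 3 * (V.card * √V.card) := by gcongr
    have h6 : (0 : ℝ) ≤ C.card ^ 3 * (V.card * √V.card) := by positivity
    nlinarith
  · rintro ⟨z, c, b⟩ _ ⟨z', c', b'⟩ _ h
    simp only [Prod.mk.injEq, Units.val_inj] at h ⊢
    obtain ⟨rfl, rfl, h⟩ := h
    exact ⟨rfl, rfl, mul_left_cancel₀ z.ne_zero (neg_injective h)⟩
  · rintro ⟨r, a, d⟩ _ ⟨r', a', d'⟩ _ h
    simp only [Prod.mk.injEq, neg_inj, Units.val_inj] at h ⊢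
    obtain ⟨rfl, rfl, h⟩ := h
    exact ⟨rfl, rfl, mul_left_cancel₀ r.ne_zero h⟩
  · rintro ⟨r, a, d⟩ _ ⟨r', a', d'⟩ _ hne U hU hinc
    simp only [Inc] at hinc
    by_cases hr : r = r'
    · subst hr
      refine le_trans (Finset.card_le_card_of_injOn (fun z => z.2.1)
        (fun z hz => (hSm.1 (hU hz)).2.1) ?_) (Nat.le_add_left _ _)
      rintro ⟨z, c, b⟩ hz ⟨z', c', b'⟩ hz' h
      obtain ⟨e1, e2⟩ := hinc _ hz
      obtain ⟨e3, e4⟩ := hinc _ hz'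
      simp only at h e1 e2 e3 e4
      subst h
      have ha : a ≠ a' := by
        rintro rfl
        apply hne
        have : (r : F) * d = r * d' := by linear_combination e1 - e2
        rw [mul_left_cancel₀ r.ne_zero this]
      have hz : (z : F) = z' := by
        refine mul_right_cancel₀ (sub_ne_zero.2 ha) ?_
        linear_combination e1 - e2 - e3 + e4
      obtain rfl := Units.ext hz
      have hb : b = b' := mul_left_cancel₀ z.ne_zero (by linear_combination e3 - e1)
      rw [hb]
    · refine le_trans (Finset.card_le_card_of_injOn (fun z => z.1)
        (fun z hz => (hSm.1 (hU hz)).1) ?_) (Nat.le_add_right _ _)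
      rintro ⟨z, c, b⟩ hz ⟨z', c', b'⟩ hz' h
      obtain ⟨e1, e2⟩ := hinc _ hz
      obtain ⟨e3, e4⟩ := hinc _ hz'
      simp only at h e1 e2 e3 e4
      subst h
      have hc : c = c' := by
        refine mul_right_cancel₀ (sub_ne_zero.2 fun h => hr (Units.ext h)) ?_
        linear_combination e2 - e1 + e3 - e4
      subst hc
      have hb : b = b' := mul_left_cancel₀ z.ne_zero (by linear_combination e3 - e1)
      rw [hb]

end Applications

section RichLines
variable {F : Type*} [Field F]

open Classical in
/-- The number of points of the grid `C × C` on the line `a = q b + s`, where `l = (q, s)`. -/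
noncomputable def richness (C : Finset F) (l : Fˣ × F) : ℕ :=
  (C.filter fun b => (l.1 : F) * b + l.2 ∈ C).card

lemma card_rich_pencil_le (C : Finset F) (U : Finset (Fˣ × F)) (k : ℕ) (b v : F)
    (hU : ∀ l ∈ U, k ≤ richness C l) (hv : ∀ l ∈ U, (l.1 : F) * b + l.2 = v) :
    U.card * (k - 1) ≤ C.card ^ 2 := by
  classical
  have h := Finset.card_mul_le_card_mul (s := U) (t := C ×ˢ C)
    (fun (l : Fˣ × F) (x : F × F) => x.1 ≠ b ∧ (l.1 : F) * x.1 + l.2 = x.2) (m := k - 1) (n := 1)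
    ?_ ?_
  · rw [Finset.card_product, mul_one] at h
    rwa [sq]
  · intro l hl
    have h1 : k - 1 ≤ ((C.filter fun c => (l.1 : F) * c + l.2 ∈ C).erase b).card :=
      (Nat.sub_le_sub_right (hU l hl) 1).trans Finset.pred_card_le_card_erase
    refine h1.trans (Finset.card_le_card_of_injOn (fun c => (c, (l.1 : F) * c + l.2)) ?_ ?_)
    · intro c hc
      have hc' := Finset.mem_erase.1 hc
      have hc'' := Finset.mem_filter.1 hc'.2
      exact Finset.mem_coe.2 ((Finset.mem_bipartiteAbove _).2
        ⟨Finset.mem_product.2 hc'', hc'.1, rfl⟩)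
    · intro c _ c' _ h
      exact (Prod.mk.inj h).1
  · rintro ⟨c, w⟩ _
    rw [Finset.card_le_one]
    rintro ⟨q, s⟩ hl ⟨q', s'⟩ hl'
    obtain ⟨hl₁, hl₂, hl₃⟩ := (Finset.mem_bipartiteBelow _).1 hl
    obtain ⟨hl₁', -, hl₃'⟩ := (Finset.mem_bipartiteBelow _).1 hl'
    have e1 := hv _ hl₁
    have e2 := hv _ hl₁'
    simp only at hl₂ hl₃ hl₃' e1 e2
    have hq : (q : F) = q' := by
      refine mul_right_cancel₀ (sub_ne_zero.2 hl₂) ?_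
      linear_combination hl₃ - e1 - hl₃' + e2
    obtain rfl := Units.ext hq
    have hs : s = s' := by linear_combination e1 - e2
    rw [hs]

lemma rich_arith {k N L : ℝ} (hk : 2 ≤ k) (hkN : k ≤ N) (hL : 0 < L)
    (h : k ^ 2 * L ^ 2 ≤ N * (3 * 10 ^ 8 * (N * L * √(N * L)) + 2 * N ^ 2 / k * (N * L))) :
    k ^ 4 * L ≤ 10 ^ 18 * N ^ 5 := by
  have hN : 0 < N := by linarith
  have hs0 : 0 ≤ √(N * L) := Real.sqrt_nonneg _
  have hs : √(N * L) ^ 2 = N * L := Real.sq_sqrt (by positivity)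
  set x := √(N * L)
  have h1 : k ^ 2 * L ≤ 3 * 10 ^ 8 * N ^ 2 * x + 2 * N ^ 4 / k := by
    refine le_of_mul_le_mul_right ?_ hL
    calc k ^ 2 * L * L = k ^ 2 * L ^ 2 := by ring
      _ ≤ _ := h
      _ = _ := by ring
  rcases le_total (k ^ 2 * L) (6 * 10 ^ 8 * N ^ 2 * x) with h2 | h2
  · have h3 : (k ^ 2 * L) ^ 2 ≤ (6 * 10 ^ 8 * N ^ 2 * x) ^ 2 :=
      pow_le_pow_left₀ (by positivity) h2 2
    have h4 : k ^ 4 * L ≤ 36 * 10 ^ 16 * N ^ 5 := by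
      refine le_of_mul_le_mul_right ?_ hL
      calc k ^ 4 * L * L = (k ^ 2 * L) ^ 2 := by ring
        _ ≤ _ := h3
        _ = 36 * 10 ^ 16 * N ^ 4 * x ^ 2 := by ring
        _ = _ := by
          rw [hs]
          ring
    have : 0 ≤ N ^ 5 := by positivity
    linarith
  · have h3 : k ^ 2 * L ≤ 4 * N ^ 4 / k := by
      have : 4 * N ^ 4 / k = 2 * (2 * N ^ 4 / k) := by ring
      linarith
    rw [le_div_iff₀ (by linarith)] at h3
    calc k ^ 4 * L = k ^ 2 * L * k * k := by ring
      _ ≤ 4 * N ^ 4 * N := by gcongr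
      _ ≤ 10 ^ 18 * N ^ 5 := by
        have : 0 ≤ N ^ 5 := by positivity
        nlinarith

lemma card_rich_le {p : ℕ} [CharP F p] (C : Finset F) (L : Finset (Fˣ × F)) {k : ℕ} (hk : 2 ≤ k)
    (hL : ∀ l ∈ L, k ≤ richness C l) (h : C.card * L.card ≤ p ^ 2) :
    (k : ℝ) ^ 4 * L.card ≤ 10 ^ 18 * C.card ^ 5 := by
  classical
  rcases L.eq_empty_or_nonempty with rfl | ⟨l₀, hl₀⟩
  · simp
  have hkN : k ≤ C.card := (hL l₀ hl₀).trans (Finset.card_filter_le _ _)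
  set S : Finset ((Fˣ × F) × F) := L ×ˢ C
  set P : F → Finset ((Fˣ × F) × F) := fun a => S.filter fun x => (x.1.1 : F) * x.2 + x.1.2 = a
  set T : Finset (((Fˣ × F) × F) × ((Fˣ × F) × F)) := C.biUnion fun u => P u ×ˢ P u
  have hS : S.card = C.card * L.card := by
    simp only [S, Finset.card_product]
    ring
  have h1 : k ^ 2 * L.card ^ 2 ≤ C.card * T.card := by
    have e1 : k * L.card ≤ ∑ a ∈ C, (P a).card := by
      have e2 : ∑ a ∈ C, (P a).card = ∑ l ∈ L, richness C l := by
        simp only [P, S, Finset.card_filter, Finset.sum_product, richness]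
        rw [Finset.sum_comm]
        refine Finset.sum_congr rfl fun l _ => ?_
        rw [Finset.sum_comm]
        exact Finset.sum_congr rfl fun b _ => Finset.sum_ite_eq _ _ _
      rw [e2, mul_comm, ← smul_eq_mul]
      exact Finset.card_nsmul_le_sum _ _ _ hL
    have e3 : T.card = ∑ a ∈ C, (P a).card ^ 2 := by
      rw [Finset.card_biUnion]
      · exact Finset.sum_congr rfl fun a _ => by rw [Finset.card_product, sq]
      · intro u _ u' _ hne
        rw [Function.onFun, Finset.disjoint_left]
        intro z hz hz'
        have e1 := (Finset.mem_filter.1 (Finset.mem_product.1 hz).1).2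
        have e2 := (Finset.mem_filter.1 (Finset.mem_product.1 hz').1).2
        exact hne (e1.symm.trans e2)
    calc k ^ 2 * L.card ^ 2 = (k * L.card) ^ 2 := by ring
      _ ≤ (∑ a ∈ C, (P a).card) ^ 2 := Nat.pow_le_pow_left e1 2
      _ ≤ C.card * ∑ a ∈ C, (P a).card ^ 2 := sq_sum_le_card_mul_sum_sq
      _ = _ := by rw [e3]
  have hSm : ∀ {z : (Fˣ × F) × F}, z ∈ S ↔ z.1 ∈ L ∧ z.2 ∈ C := by
    intro z
    simp only [S, Finset.mem_product]
  have hmem : ∀ z ∈ T, (z.1 ∈ S ∧ z.2 ∈ S) ∧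
      (z.1.1.1 : F) * z.1.2 + z.1.1.2 = z.2.1.1 * z.2.2 + z.2.1.2 := by
    intro z hz
    obtain ⟨u, -, hu⟩ := Finset.mem_biUnion.1 hz
    obtain ⟨hu₁, hu₂⟩ := Finset.mem_product.1 hu
    obtain ⟨hu₁, e1⟩ := Finset.mem_filter.1 hu₁
    obtain ⟨hu₂, e2⟩ := Finset.mem_filter.1 hu₂
    exact ⟨⟨hu₁, hu₂⟩, e1.trans e2.symm⟩
  have h2 := card_le_of_incidences (p := p) S S (fun z => (z.2, (z.1.1 : F), z.1.2))
    (fun z => (-(z.1.1 : F), z.2, -z.1.2)) ?_ ?_ hS hS h (k := 2 * C.card ^ 2 / k) ?_ T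
    (fun z => (z.1.1, z.2.2)) (fun z => (z.2.1, z.1.2))
    (fun z hz => by
      have := (hmem z hz).1
      rw [hSm, hSm] at this
      exact hSm.2 ⟨this.1.1, this.2.2⟩)
    (fun z hz => by
      have := (hmem z hz).1
      rw [hSm, hSm] at this
      exact hSm.2 ⟨this.2.1, this.1.2⟩)
    (by
      rintro ⟨⟨l, b⟩, l', b'⟩ _ ⟨⟨l₁, b₁⟩, l₁', b₁'⟩ _ h
      simp only [Prod.mk.injEq] at h ⊢
      tauto)
    (fun z hz => by
      have := (hmem z hz).2
      simp only [Inc]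
      linear_combination this)
  · refine rich_arith (by exact_mod_cast hk) (by exact_mod_cast hkN)
      (by exact_mod_cast Finset.card_pos.2 ⟨l₀, hl₀⟩) ?_
    have h1' : (k : ℝ) ^ 2 * L.card ^ 2 ≤ C.card * T.card := by exact_mod_cast h1
    refine h1'.trans ?_
    gcongr
    refine h2.trans ?_
    have h3 : ((2 * C.card ^ 2 / k : ℕ) : ℝ) ≤ 2 * C.card ^ 2 / k := by
      refine Nat.cast_div_le.trans ?_
      push_cast
      rfl
    push_cast
    gcongr
  · rintro ⟨⟨q, s⟩, b⟩ _ ⟨⟨q', s'⟩, b'⟩ _ h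
    simp only [Prod.mk.injEq, Units.val_inj] at h ⊢
    tauto
  · rintro ⟨⟨q, s⟩, b⟩ _ ⟨⟨q', s'⟩, b'⟩ _ h
    simp only [Prod.mk.injEq, neg_inj, Units.val_inj] at h ⊢
    tauto
  · rintro ⟨⟨q, s⟩, b⟩ _ ⟨⟨q', s'⟩, b'⟩ _ hne U hU hinc
    simp only [Inc] at hinc
    rw [Nat.le_div_iff_mul_le (by omega)]
    by_cases hb : b = b'
    · subst hb
      rcases U.eq_empty_or_nonempty with rfl | ⟨u₀, hu₀⟩
      · simp
      have hconst : ∀ u ∈ U, u.2 = u₀.2 := by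
        intro u hu
        obtain ⟨e1, e2⟩ := hinc u hu
        obtain ⟨e3, e4⟩ := hinc u₀ hu₀
        have hq : (q : F) ≠ q' := by
          intro hq
          apply hne
          have hs : s = s' := by linear_combination -e1 + e2 - u.2 * hq
          rw [Units.ext hq, hs]
        refine mul_right_cancel₀ (sub_ne_zero.2 hq) ?_
        linear_combination -e1 + e2 + e3 - e4
      have h3 := card_rich_pencil_le C (U.image Prod.fst) k b (u₀.2 * q + s)
        (by
          simp only [Finset.forall_mem_image]
          exact fun u hu => hL _ (hSm.1 (hU hu)).1)
        (by
          simp only [Finset.forall_mem_image]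
          intro u hu
          have := (hinc u hu).1
          rw [hconst u hu] at this
          linear_combination this)
      rw [Finset.card_image_of_injOn (fun u hu u' hu' h => Prod.ext h
        ((hconst u hu).trans (hconst u' hu').symm))] at h3
      obtain ⟨j, rfl⟩ : ∃ j, k = j + 1 := ⟨k - 1, by omega⟩
      rw [Nat.add_sub_cancel] at h3
      nlinarith
    · have h3 : U.card ≤ C.card := by
        refine Finset.card_le_card_of_injOn (fun u => u.2) (fun u hu => (hSm.1 (hU hu)).2) ?_
        rintro ⟨⟨q₁, s₁⟩, c⟩ hz ⟨⟨q₂, s₂⟩, c'⟩ hz' h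
        obtain ⟨e1, e2⟩ := hinc _ hz
        obtain ⟨e3, e4⟩ := hinc _ hz'
        simp only at h e1 e2 e3 e4
        subst h
        have hq : (q₁ : F) = q₂ := by
          refine mul_right_cancel₀ (sub_ne_zero.2 hb) ?_
          linear_combination e1 - e2 - e3 + e4
        have hs : s₁ = s₂ := by linear_combination e1 - e3 - b * hq
        rw [Units.ext hq, hs]
      nlinarith

end RichLines

section ThirdMoment
variable {F : Type*} [Field F] [Fintype F] [Fintype Fˣ]

omit [Fintype Fˣ] in
lemma sum_richness (C : Finset F) (q : Fˣ) : ∑ s, richness C (q, s) = C.card ^ 2 := by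
  classical
  simp only [richness, Finset.card_filter]
  rw [Finset.sum_comm, sq, ← smul_eq_mul, Finset.card_eq_sum_ones C, Finset.sum_smul]
  refine Finset.sum_congr rfl fun b _ => ?_
  exact (Equiv.sum_comp (Equiv.addLeft ((q : F) * b)) fun s => if s ∈ C then 1 else 0).trans
    (by simp)

omit [Fintype F] [Fintype Fˣ] in
open Classical in
lemma offDiag_rich_arith (C : Finset F) (l : Fˣ × F) :
    ((C.filter fun b => (l.1 : F) * b + l.2 ∈ C).offDiag).card =
      richness C l * richness C l - richness C l :=
  Finset.offDiag_card _

lemma corr_diffs_le (C : Finset F) (q : Fˣ) :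
    corr (diffs C) q ≤
      ((∑ s, (richness C (q, s) * richness C (q, s) - richness C (q, s)) : ℕ) : ℝ) := by
  classical
  set X : Fˣ → Finset (F × F) := fun d => (C ×ˢ C).filter fun x => x.1 - x.2 = d
  set T : Finset ((F × F) × (F × F)) := Finset.univ.biUnion fun d => X d ×ˢ X (q * d)
  have h1 : corr (diffs C) q = T.card := by
    rw [corr, Finset.card_biUnion, Nat.cast_sum]
    · refine Finset.sum_congr rfl fun d _ => ?_
      rw [Finset.card_product, Nat.cast_mul]
      simp only [diffs, X]
    · intro u _ u' _ hne
      rw [Function.onFun, Finset.disjoint_left]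
      intro z hz hz'
      have e1 := (Finset.mem_filter.1 (Finset.mem_product.1 hz).1).2
      have e2 := (Finset.mem_filter.1 (Finset.mem_product.1 hz').1).2
      exact hne (Units.ext (e1.symm.trans e2))
  rw [h1, Nat.cast_le]
  have h2 : T.card ≤ (Finset.univ.sigma fun s : F =>
      (C.filter fun b => (q : F) * b + s ∈ C).offDiag).card := by
    refine Finset.card_le_card_of_injOn (fun z => ⟨z.2.1 - q * z.1.1, z.1⟩) ?_ ?_
    · rintro ⟨⟨c, d⟩, a, b⟩ hz
      obtain ⟨u, -, hu⟩ := Finset.mem_biUnion.1 hz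
      obtain ⟨hu₁, hu₂⟩ := Finset.mem_product.1 hu
      obtain ⟨hu₁, e1⟩ := Finset.mem_filter.1 hu₁
      obtain ⟨hu₂, e2⟩ := Finset.mem_filter.1 hu₂
      obtain ⟨hc, hd⟩ := Finset.mem_product.1 hu₁
      obtain ⟨ha, hb⟩ := Finset.mem_product.1 hu₂
      simp only [Units.val_mul] at e1 e2 hc hd ha hb
      have e3 : (q : F) * d + (a - q * c) = b := by linear_combination e2 - q * e1
      have e4 : c ≠ d := by
        rintro rfl
        rw [sub_self] at e1
        exact u.ne_zero e1.symm
      simp only [Finset.coe_sigma, Finset.coe_univ, Set.mem_sigma_iff, Set.mem_univ, true_and,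
        Finset.mem_coe, Finset.mem_offDiag, Finset.mem_filter, add_sub_cancel, e3]
      exact ⟨⟨hc, ha⟩, ⟨hd, hb⟩, e4⟩
    · rintro ⟨⟨c, d⟩, a, b⟩ hz ⟨⟨c', d'⟩, a', b'⟩ hz' h
      have key : ∀ {c d a b : F}, ((c, d), (a, b)) ∈ T → a - b = q * (c - d) := by
        intro c d a b hz
        obtain ⟨u, -, hu⟩ := Finset.mem_biUnion.1 hz
        have e1 := (Finset.mem_filter.1 (Finset.mem_product.1 hu).1).2
        have e2 := (Finset.mem_filter.1 (Finset.mem_product.1 hu).2).2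
        simp only [Units.val_mul] at e1 e2
        rw [e1, e2]
      have k1 := key hz
      have k2 := key hz'
      simp only [Sigma.mk.injEq, heq_eq_eq, Prod.mk.injEq] at h ⊢
      obtain ⟨h, rfl, rfl⟩ := h
      have ha : a = a' := sub_left_injective h
      subst ha
      exact ⟨⟨rfl, rfl⟩, rfl, by linear_combination -k1 + k2⟩
  refine h2.trans (le_of_eq ?_)
  rw [Finset.card_sigma]
  exact Finset.sum_congr rfl fun s _ => offDiag_rich_arith C (q, s)

omit [Fintype F] [Fintype Fˣ] in
lemma card_rich_mul_sq_le (C : Finset F) (L : Finset (Fˣ × F)) {k : ℕ} (hk : 2 ≤ k)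
    (hL : ∀ l ∈ L, k ≤ richness C l) : k ^ 2 * L.card ≤ 2 * C.card ^ 4 := by
  classical
  have h1 : (L.sigma fun l : Fˣ × F => (C.filter fun b => (l.1 : F) * b + l.2 ∈ C).offDiag).card ≤
      ((C ×ˢ C) ×ˢ (C ×ˢ C)).card := by
    refine Finset.card_le_card_of_injOn
      (fun z => (z.2, ((z.1.1 : F) * z.2.1 + z.1.2, (z.1.1 : F) * z.2.2 + z.1.2))) ?_ ?_
    · rintro ⟨l, c, d⟩ hz
      have hz' := (Finset.mem_sigma.1 hz).2
      simp only [Finset.mem_offDiag, Finset.mem_filter] at hz'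
      simp only [Finset.coe_product, Set.mem_prod, Finset.mem_coe]
      tauto
    · rintro ⟨⟨q, s⟩, c, d⟩ hz ⟨⟨q', s'⟩, c', d'⟩ - h
      have hm := (Finset.mem_sigma.1 hz).2
      simp only [Finset.mem_offDiag, Finset.mem_filter] at hm
      simp only [Prod.mk.injEq] at h
      obtain ⟨⟨rfl, rfl⟩, e1, e2⟩ := h
      have hq : (q : F) = q' := by
        refine mul_right_cancel₀ (sub_ne_zero.2 hm.2.2) ?_
        linear_combination e1 - e2
      have hs : s = s' := by linear_combination e1 - c * hq
      rw [Units.ext hq, hs]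
  rw [Finset.card_sigma] at h1
  simp only [offDiag_rich_arith, Finset.card_product] at h1
  have h2 : L.card * k ^ 2 ≤ ∑ l ∈ L, 2 * (richness C l * richness C l - richness C l) := by
    rw [← smul_eq_mul]
    refine Finset.card_nsmul_le_sum _ _ _ fun l hl => ?_
    have := hL l hl
    have h3 : 2 * richness C l ≤ richness C l * richness C l := by nlinarith
    zify [(by omega : richness C l ≤ richness C l * richness C l)] at *
    nlinarith
  rw [← Finset.mul_sum] at h2
  nlinarith

omit [Fintype F] [Fintype Fˣ] in
lemma card_rich_univ_le {p : ℕ} [CharP F p] (C : Finset F) (L : Finset (Fˣ × F)) {k : ℕ}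
    (hk : 2 ≤ k) (hL : ∀ l ∈ L, k ≤ richness C l) (hC : C.card ^ 2 ≤ p) :
    k ^ 4 * L.card ≤ 10 ^ 18 * C.card ^ 5 := by
  classical
  rcases L.eq_empty_or_nonempty with rfl | ⟨l₀, hl₀⟩
  · simp
  have hkN : k ≤ C.card := (hL l₀ hl₀).trans (Finset.card_filter_le _ _)
  set N := C.card
  have hN0 : 0 < N := by omega
  have hN4 : N ^ 4 ≤ p ^ 2 := by
    calc N ^ 4 = (N ^ 2) ^ 2 := by ring
      _ ≤ p ^ 2 := Nat.pow_le_pow_left hC 2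
  rcases le_total (2 * 10 ^ 18 * N ^ 2) (k ^ 4) with h | h
  · by_contra! hlt
    have hk0 : 0 < k ^ 4 := by positivity
    obtain ⟨m, hm⟩ : ∃ m, m = 10 ^ 18 * N ^ 5 / k ^ 4 := ⟨_, rfl⟩
    have hm1 : m < L.card := by
      rw [hm]
      exact Nat.div_lt_of_lt_mul hlt
    have hm2 : m * k ^ 4 ≤ 10 ^ 18 * N ^ 5 := by
      rw [hm]
      exact Nat.div_mul_le_self _ _
    have hm3 : 10 ^ 18 * N ^ 5 < k ^ 4 * (m + 1) := by
      rw [hm]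
      exact Nat.lt_mul_div_succ _ hk0
    obtain ⟨L', hL', hc⟩ := Finset.exists_subset_card_eq (show m + 1 ≤ L.card by omega)
    have hm4 : 2 * m ≤ N ^ 3 := by
      have h1 : m * (2 * 10 ^ 18 * N ^ 2) ≤ 10 ^ 18 * N ^ 5 :=
        (Nat.mul_le_mul_left m h).trans hm2
      refine Nat.le_of_mul_le_mul_left (c := 10 ^ 18 * N ^ 2) ?_ (by positivity)
      nlinarith
    have h1 := card_rich_le (p := p) C L' hk (fun l hl => hL l (hL' hl)) (by
      rw [hc]
      change N * (m + 1) ≤ p ^ 2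
      have h2 : 2 * 2 * 2 ≤ N ^ 3 := by
        calc 2 * 2 * 2 = 2 ^ 3 := by norm_num
          _ ≤ N ^ 3 := Nat.pow_le_pow_left (by omega) 3
      have h3 : N * (m + 1) ≤ N * N ^ 3 := Nat.mul_le_mul_left _ (by omega)
      calc N * (m + 1) ≤ N * N ^ 3 := h3
        _ = N ^ 4 := by ring
        _ ≤ p ^ 2 := hN4)
    rw [hc] at h1
    have h2 : k ^ 4 * (m + 1) ≤ 10 ^ 18 * N ^ 5 := by exact_mod_cast h1
    omega
  · have h1 := card_rich_mul_sq_le C L hk hL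
    have h2 : k ^ 2 ≤ 2 * 10 ^ 9 * N := by
      refine le_of_pow_le_pow_left₀ two_ne_zero (Nat.zero_le _) ?_
      calc (k ^ 2) ^ 2 = k ^ 4 := by ring
        _ ≤ 2 * 10 ^ 18 * N ^ 2 := h
        _ ≤ (2 * 10 ^ 9 * N) ^ 2 := by nlinarith
    calc k ^ 4 * L.card = k ^ 2 * (k ^ 2 * L.card) := by ring
      _ ≤ (2 * 10 ^ 9 * N) * (2 * N ^ 4) := Nat.mul_le_mul h2 h1
      _ = 4 * 10 ^ 9 * N ^ 5 := by ring
      _ ≤ _ := by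
        gcongr
        norm_num

open Classical in
/-- The number of lines of slope `q` whose richness lies in `[2 ^ (i + 1), 2 ^ (i + 2))`. -/
noncomputable def bandCount (C : Finset F) (i : ℕ) (q : Fˣ) : ℕ :=
  (Finset.univ.filter fun s => 2 ^ (i + 1) ≤ richness C (q, s) ∧
    richness C (q, s) < 2 ^ (i + 2)).card

lemma corr_diffs_le_bands (C : Finset F) {K : ℕ} (hK : C.card < 2 ^ K) (q : Fˣ) :
    corr (diffs C) q ≤ ∑ i ∈ Finset.range K, (4 * (2 ^ (i + 1)) ^ 2 * bandCount C i q : ℝ) := by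
  classical
  have h : ∑ s, (richness C (q, s) * richness C (q, s) - richness C (q, s)) ≤
      ∑ i ∈ Finset.range K, 4 * (2 ^ (i + 1)) ^ 2 * bandCount C i q := by
    simp only [bandCount, Finset.card_filter, Finset.mul_sum]
    rw [Finset.sum_comm]
    refine Finset.sum_le_sum fun s _ => ?_
    rcases lt_or_ge (richness C (q, s)) 2 with h2 | h2
    · interval_cases richness C (q, s) <;> simp
    · obtain ⟨i, hi₁, hi₂⟩ := exists_nat_pow_near (x := richness C (q, s)) (y := 2) (by omega)
        (by norm_num)
      have hi0 : i ≠ 0 := by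
        rintro rfl
        omega
      obtain ⟨j, rfl⟩ := Nat.exists_eq_succ_of_ne_zero hi0
      have hjK : j + 1 < K := by
        refine (Nat.pow_lt_pow_iff_right one_lt_two).1 (hi₁.trans_lt (lt_of_le_of_lt ?_ hK))
        exact Finset.card_filter_le _ _
      refine le_trans ?_ (Finset.single_le_sum (fun _ _ => Nat.zero_le _)
        (Finset.mem_range.2 (by omega : j < K)))
      rw [if_pos ⟨hi₁, hi₂⟩, mul_one]
      refine (Nat.sub_le _ _).trans ?_
      have e : (2 : ℕ) ^ (j.succ + 1) = 2 * 2 ^ (j + 1) := pow_succ' _ _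
      rw [e] at hi₂
      nlinarith
  refine (corr_diffs_le C q).trans ?_
  exact_mod_cast h

lemma sum_bandCount_cube_le {p : ℕ} [CharP F p] (C : Finset F) (hC : C.card ^ 2 ≤ p) (i : ℕ) :
    ∑ q, (2 ^ (i + 1)) ^ 6 * bandCount C i q ^ 3 ≤ 10 ^ 18 * C.card ^ 9 := by
  classical
  set k := 2 ^ (i + 1) with hk
  have hk2 : 2 ≤ k := by
    rw [hk, pow_succ]
    have := Nat.one_le_two_pow (n := i)
    omega
  have h1 : ∀ q, k * bandCount C i q ≤ C.card ^ 2 := by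
    intro q
    rw [← sum_richness C q, mul_comm, ← smul_eq_mul]
    exact (Finset.card_nsmul_le_sum _ _ _ fun s hs => (Finset.mem_filter.1 hs).2.1).trans
      (Finset.sum_le_sum_of_subset (Finset.subset_univ _))
  have h2 : ∑ q, bandCount C i q = (Finset.univ.filter fun l : Fˣ × F =>
      k ≤ richness C l ∧ richness C l < 2 ^ (i + 2)).card := by
    simp only [bandCount, Finset.card_filter, Fintype.sum_prod_type]
    rfl
  have h3 := card_rich_univ_le (p := p) C (Finset.univ.filter fun l : Fˣ × F =>
      k ≤ richness C l ∧ richness C l < 2 ^ (i + 2)) hk2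
      (fun l hl => (Finset.mem_filter.1 hl).2.1) hC
  rw [← h2] at h3
  calc ∑ q, k ^ 6 * bandCount C i q ^ 3 ≤
      ∑ q, k ^ 4 * (C.card ^ 2) ^ 2 * bandCount C i q := by
        refine Finset.sum_le_sum fun q _ => ?_
        calc k ^ 6 * bandCount C i q ^ 3 =
            k ^ 4 * (k * bandCount C i q) ^ 2 * bandCount C i q := by ring
          _ ≤ _ := by
            gcongr
            exact h1 q
    _ = (k ^ 4 * ∑ q, bandCount C i q) * C.card ^ 4 := by
      rw [← Finset.mul_sum]
      ring
    _ ≤ (10 ^ 18 * C.card ^ 5) * C.card ^ 4 := Nat.mul_le_mul_right _ h3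
    _ = _ := by ring

lemma sum_corr_diffs_cube_le {p : ℕ} [CharP F p] (C : Finset F) (hC : C.card ^ 2 ≤ p) {K : ℕ}
    (hK : C.card < 2 ^ K) :
    ∑ q, corr (diffs C) q ^ 3 ≤ 64 * 10 ^ 18 * K ^ 3 * C.card ^ 9 := by
  have hd : 0 ≤ diffs C := fun u => Nat.cast_nonneg _
  have h1 : ∀ q, corr (diffs C) q ^ 3 ≤ (K : ℝ) ^ 2 *
      ∑ i ∈ Finset.range K, (4 * (2 ^ (i + 1)) ^ 2 * bandCount C i q : ℝ) ^ 3 := by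
    intro q
    refine (pow_le_pow_left₀ (corr_nonneg hd q) (corr_diffs_le_bands C hK q) 3).trans ?_
    rcases Nat.eq_zero_or_pos K with rfl | hK0
    · simp
    have h3 := pow_sum_div_card_le_sum_pow (s := Finset.range K)
      (f := fun i => (4 * (2 ^ (i + 1)) ^ 2 * bandCount C i q : ℝ))
      (fun i _ => by positivity) 2
    rw [Finset.card_range, div_le_iff₀ (by positivity)] at h3
    exact h3.trans (le_of_eq (mul_comm _ _))
  calc ∑ q, corr (diffs C) q ^ 3 ≤ ∑ q, (K : ℝ) ^ 2 *
      ∑ i ∈ Finset.range K, (4 * (2 ^ (i + 1)) ^ 2 * bandCount C i q : ℝ) ^ 3 :=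
        Finset.sum_le_sum fun q _ => h1 q
    _ = (K : ℝ) ^ 2 * ∑ i ∈ Finset.range K,
        64 * ((∑ q, (2 ^ (i + 1)) ^ 6 * bandCount C i q ^ 3 : ℕ) : ℝ) := by
      rw [← Finset.mul_sum, Finset.sum_comm]
      push_cast
      simp only [Finset.mul_sum]
      refine Finset.sum_congr rfl fun i _ => Finset.sum_congr rfl fun q _ => by ring
    _ ≤ (K : ℝ) ^ 2 * ∑ i ∈ Finset.range K, 64 * (10 ^ 18 * C.card ^ 9 : ℝ) := by
      gcongr with i _
      exact_mod_cast sum_bandCount_cube_le C hC i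
    _ = _ := by
      rw [Finset.sum_const, Finset.card_range, nsmul_eq_mul]
      ring

end ThirdMoment

section SecondMoment
variable {F : Type*} [Field F] [Fintype Fˣ]

omit [Fintype Fˣ] in
lemma diffs_nonneg (C : Finset F) : 0 ≤ diffs C := fun _ => Nat.cast_nonneg _

lemma sum_diffs_le (C : Finset F) : ∑ d, diffs C d ≤ (C.card : ℝ) ^ 2 := by
  classical
  have h : (Finset.univ.biUnion fun d : Fˣ =>
      (C ×ˢ C).filter fun x => x.1 - x.2 = (d : F)).card ≤ (C ×ˢ C).card :=
    Finset.card_le_card (Finset.biUnion_subset.2 fun d _ => Finset.filter_subset _ _)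
  rw [Finset.card_biUnion, Finset.card_product, ← sq] at h
  · simp only [diffs]
    exact_mod_cast h
  · intro u _ u' _ hne
    rw [Function.onFun, Finset.disjoint_left]
    intro z hz hz'
    exact hne (Units.ext ((Finset.mem_filter.1 hz).2.symm.trans (Finset.mem_filter.1 hz').2))

lemma corr_diffs_eq_zero_or_one_le (C : Finset F) (q : Fˣ) :
    corr (diffs C) q = 0 ∨ 1 ≤ corr (diffs C) q := by
  classical
  obtain ⟨n, hn⟩ : ∃ n : ℕ, corr (diffs C) q = n :=
    ⟨∑ d : Fˣ, ((C ×ˢ C).filter fun x => x.1 - x.2 = (d : F)).card *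
      ((C ×ˢ C).filter fun x => x.1 - x.2 = ((q * d : Fˣ) : F)).card, by
        rw [corr]
        push_cast
        simp only [diffs, Units.val_mul]⟩
  rw [hn]
  rcases n with _ | n
  · simp
  · right
    exact_mod_cast Nat.succ_pos n

lemma corr_diffs_le_cube [Fintype F] (C : Finset F) (q : Fˣ) :
    corr (diffs C) q ≤ (C.card : ℝ) ^ 3 := by
  classical
  refine (corr_diffs_le C q).trans ?_
  have h : ∑ s, (richness C (q, s) * richness C (q, s) - richness C (q, s)) ≤ C.card ^ 3 := by
    calc ∑ s, (richness C (q, s) * richness C (q, s) - richness C (q, s)) ≤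
        ∑ s, C.card * richness C (q, s) := by
          refine Finset.sum_le_sum fun s _ => (Nat.sub_le _ _).trans ?_
          exact Nat.mul_le_mul_right _ (Finset.card_filter_le _ _)
      _ = C.card ^ 3 := by
        rw [← Finset.mul_sum, sum_richness]
        ring
  exact_mod_cast h

omit [Fintype Fˣ] [Field F] in
lemma moment_arith {D T N L A M : ℝ} (hD : 0 ≤ D) (hN : 1 ≤ N) (hL : 1 ≤ L) (hA : 1 ≤ A)
    (hM : 1 ≤ M) (hT : 0 ≤ T) (hTL : T ≤ L * N ^ 9)
    (h : D ^ 7 ≤ A * N ^ 12 * T ^ 2 * (M * N ^ 3 * (√D * T) + N ^ 2 * D ^ 2)) :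
    D ^ 13 ≤ (2 * A * M * L ^ 3) ^ 3 * N ^ 84 := by
  rcases hD.eq_or_lt with rfl | hD
  · rw [zero_pow (by norm_num)]
    positivity
  have hs : √D ^ 2 = D := Real.sq_sqrt hD.le
  have hs0 : 0 < √D := Real.sqrt_pos.2 hD
  have hG : 1 ≤ 2 * A * M * L ^ 3 := by
    calc (1 : ℝ) ≤ 2 * 1 * 1 * 1 ^ 3 := by norm_num
      _ ≤ _ := by gcongr
  have h1 : D ^ 7 ≤ A * N ^ 12 * (L * N ^ 9) ^ 2 *
      (M * N ^ 3 * (√D * (L * N ^ 9)) + N ^ 2 * D ^ 2) := h.trans (by gcongr)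
  rcases le_total (N ^ 2 * D ^ 2) (M * N ^ 3 * (√D * (L * N ^ 9))) with h2 | h2
  · have h3 : D ^ 7 ≤ 2 * A * M * L ^ 3 * N ^ 42 * √D := by
      calc D ^ 7 ≤ A * N ^ 12 * (L * N ^ 9) ^ 2 *
            (M * N ^ 3 * (√D * (L * N ^ 9)) + M * N ^ 3 * (√D * (L * N ^ 9))) :=
              h1.trans (by gcongr)
        _ = _ := by ring
    have h4 : D ^ 13 * D ≤ ((2 * A * M * L ^ 3) ^ 2 * N ^ 84) * D := by
      calc D ^ 13 * D = (D ^ 7) ^ 2 := by ring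
        _ ≤ (2 * A * M * L ^ 3 * N ^ 42 * √D) ^ 2 := by gcongr
        _ = (2 * A * M * L ^ 3) ^ 2 * N ^ 84 * √D ^ 2 := by ring
        _ = _ := by rw [hs]
    refine (le_of_mul_le_mul_right h4 hD).trans ?_
    gcongr
    norm_num
  · have h3 : D ^ 5 * D ^ 2 ≤ (2 * A * M * L ^ 3 * N ^ 32) * D ^ 2 := by
      calc D ^ 5 * D ^ 2 = D ^ 7 := by ring
        _ ≤ A * N ^ 12 * (L * N ^ 9) ^ 2 * (N ^ 2 * D ^ 2 + N ^ 2 * D ^ 2) :=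
          h1.trans (by gcongr)
        _ = 2 * A * 1 * (L ^ 2 * 1) * N ^ 32 * D ^ 2 := by ring
        _ ≤ 2 * A * M * (L ^ 2 * L) * N ^ 32 * D ^ 2 := by gcongr
        _ = _ := by ring
    have h4 : D ^ 5 ≤ 2 * A * M * L ^ 3 * N ^ 32 := le_of_mul_le_mul_right h3 (by positivity)
    refine le_of_pow_le_pow_left₀ (n := 5) (by norm_num) (by positivity) ?_
    calc (D ^ 13) ^ 5 = (D ^ 5) ^ 13 := by ring
      _ ≤ (2 * A * M * L ^ 3 * N ^ 32) ^ 13 := by gcongr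
      _ = (2 * A * M * L ^ 3) ^ 13 * N ^ 416 := by ring
      _ ≤ (2 * A * M * L ^ 3) ^ 15 * N ^ 420 := by
        gcongr
        · norm_num
        · norm_num
      _ = _ := by ring

lemma sum_corr_diffs_sq_pow_le [Fintype F] {p : ℕ} [CharP F p] (hF : Fintype.card Fˣ ≤ p)
    (C : Finset F) (hC : C.card ^ 2 ≤ p) (hC0 : C.Nonempty) {K : ℕ} (hK : C.card ^ 3 < 2 ^ K) :
    (∑ q, corr (diffs C) q ^ 2) ^ 13 ≤ (10 ^ 73 * (K : ℝ) ^ 11) ^ 3 * (C.card : ℝ) ^ 84 := by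
  classical
  have hN : 1 ≤ C.card := hC0.card_pos
  have hK0 : 1 ≤ K := by
    rcases K with _ | K
    · have := Nat.one_le_pow 3 _ hN
      omega
    · omega
  have hd := diffs_nonneg C
  have hT : 0 ≤ ∑ q, corr (diffs C) q ^ 3 :=
    Finset.sum_nonneg fun q _ => pow_nonneg (corr_nonneg hd q) 3
  have hD : 0 ≤ ∑ q, corr (diffs C) q ^ 2 := Finset.sum_nonneg fun q _ => sq_nonneg _
  have hS0 : 0 ≤ ∑ d, diffs C d := Finset.sum_nonneg fun d _ => hd d
  have hS : (∑ d, diffs C d) ^ 6 ≤ ((C.card : ℝ) ^ 2) ^ 6 :=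
    pow_le_pow_left₀ hS0 (sum_diffs_le C) 6
  have h1 := corrForm_sq_le hd (corr_diffs_eq_zero_or_one_le C)
    (fun y => (corr_diffs_le_cube C y).trans_lt (by exact_mod_cast hK))
    (a := 4 * 10 ^ 8 * (C.card : ℝ) ^ 3) (b := (C.card : ℝ) ^ 2) (by positivity) (by positivity)
    (fun V => by
      convert corrForm_diffs_le (p := p) C V (by
        rw [sq p]
        exact Nat.mul_le_mul hC ((Finset.card_le_univ V).trans hF)))
  have h2 := (sum_corr_sq_pow_seven_le hd).trans (mul_le_mul_of_nonneg_left h1 (by positivity))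
  have h3 := sum_corr_diffs_cube_le (p := p) C hC (K := K)
    ((Nat.le_self_pow (by norm_num) _).trans_lt hK)
  have hK1 : (1 : ℝ) ≤ K := by exact_mod_cast hK0
  have hN1 : (1 : ℝ) ≤ C.card := by exact_mod_cast hN
  set D := ∑ q, corr (diffs C) q ^ 2
  set T := ∑ q, corr (diffs C) q ^ 3
  have hK2 : (1 : ℝ) ≤ K ^ 2 := one_le_pow₀ hK1
  have hK3 : (1 : ℝ) ≤ K ^ 3 := one_le_pow₀ hK1
  refine (moment_arith (L := 64 * 10 ^ 18 * (K : ℝ) ^ 3) (A := 8192 * (K : ℝ) ^ 2)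
    (M := 4 * 10 ^ 8) hD hN1 (by linarith) (by linarith) (by norm_num) hT h3 ?_).trans ?_
  · refine h2.trans ?_
    calc 512 * (∑ d, diffs C d) ^ 6 * T ^ 2 * (16 * (K : ℝ) ^ 2 *
          (4 * 10 ^ 8 * (C.card : ℝ) ^ 3 * (√D * T) + (C.card : ℝ) ^ 2 * D ^ 2)) ≤
        512 * ((C.card : ℝ) ^ 2) ^ 6 * T ^ 2 * (16 * (K : ℝ) ^ 2 *
          (4 * 10 ^ 8 * (C.card : ℝ) ^ 3 * (√D * T) + (C.card : ℝ) ^ 2 * D ^ 2)) := by gcongr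
      _ = _ := by ring
  · have e : 2 * (8192 * (K : ℝ) ^ 2) * (4 * 10 ^ 8) * (64 * 10 ^ 18 * (K : ℝ) ^ 3) ^ 3 =
        (2 * 8192 * (4 * 10 ^ 8) * (64 * 10 ^ 18) ^ 3) * (K : ℝ) ^ 11 := by ring
    rw [e]
    gcongr
    norm_num

lemma card_pow_four_le [DecidableEq F] (C : Finset F) (y : Fˣ) :
    (C.card : ℝ) ^ 4 ≤ ((C ×ˢ C).image fun z => z.1 * (y : F) + z.2).card *
      ((C.card : ℝ) ^ 2 + corr (diffs C) y) := by
  classical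
  set g : F × F → F := fun z => z.1 * (y : F) + z.2
  set W := (C ×ˢ C).image g
  set fib : F → Finset (F × F) := fun w => (C ×ˢ C).filter fun z => g z = w
  set Q : Finset (Σ _ : F, (F × F) × (F × F)) := W.sigma fun w => fib w ×ˢ fib w
  have h1 : C.card ^ 2 = ∑ w ∈ W, (fib w).card := by
    rw [sq, ← Finset.card_product]
    exact Finset.card_eq_sum_card_image g (C ×ˢ C)
  have h2 : C.card ^ 4 ≤ W.card * Q.card := by
    have h := sq_sum_le_card_mul_sum_sq (s := W) (f := fun w => (fib w).card)
    rw [← h1] at h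
    rw [Finset.card_sigma]
    simp only [Finset.card_product, ← sq]
    calc C.card ^ 4 = (C.card ^ 2) ^ 2 := by ring
      _ ≤ _ := h
  set X : Fˣ → Finset (F × F) := fun d => (C ×ˢ C).filter fun x => x.1 - x.2 = d
  set T : Finset ((F × F) × (F × F)) := Finset.univ.biUnion fun d => X d ×ˢ X (y * d)
  set R : Finset ((F × F) × (F × F)) := ((C ×ˢ C).image fun z => ((z.1, z.1), (z.2, z.2))) ∪ T
  have h3 : Q.card ≤ R.card := by
    refine Finset.card_le_card_of_injOn
      (fun z => ((z.2.1.1, z.2.2.1), (z.2.2.2, z.2.1.2))) ?_ ?_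
    · rintro ⟨w, ⟨a, b⟩, c, d⟩ hz
      obtain ⟨hz₁, hz₂⟩ := Finset.mem_product.1 (Finset.mem_sigma.1 hz).2
      obtain ⟨hab, e1⟩ := Finset.mem_filter.1 hz₁
      obtain ⟨hcd, e2⟩ := Finset.mem_filter.1 hz₂
      obtain ⟨ha, hb⟩ := Finset.mem_product.1 hab
      obtain ⟨hc, hd⟩ := Finset.mem_product.1 hcd
      simp only [g] at e1 e2 ha hb hc hd
      refine Finset.mem_union.2 ?_
      by_cases hac : a = c
      · left
        subst hac
        have hbd : b = d := by linear_combination e1 - e2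
        subst hbd
        exact Finset.mem_image.2 ⟨(a, b), hab, rfl⟩
      · right
        refine Finset.mem_biUnion.2 ⟨Units.mk0 (a - c) (sub_ne_zero.2 hac), Finset.mem_univ _, ?_⟩
        refine Finset.mem_product.2
          ⟨Finset.mem_filter.2 ⟨Finset.mem_product.2 ⟨ha, hc⟩, rfl⟩,
            Finset.mem_filter.2 ⟨Finset.mem_product.2 ⟨hd, hb⟩, ?_⟩⟩
        simp only [Units.val_mul, Units.val_mk0]
        linear_combination e2 - e1
    · rintro ⟨w, ⟨a, b⟩, c, d⟩ hz ⟨w', ⟨a', b'⟩, c', d'⟩ hz' h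
      have k1 := (Finset.mem_filter.1 (Finset.mem_product.1 (Finset.mem_sigma.1 hz).2).1).2
      have k2 := (Finset.mem_filter.1 (Finset.mem_product.1 (Finset.mem_sigma.1 hz').2).1).2
      simp only [Prod.mk.injEq] at h
      obtain ⟨⟨rfl, rfl⟩, rfl, rfl⟩ := h
      have hw : w = w' := k1.symm.trans k2
      subst hw
      rfl
  have h4 : (T.card : ℝ) ≤ corr (diffs C) y := by
    have h := Finset.card_biUnion_le (s := (Finset.univ : Finset Fˣ))
      (t := fun d => X d ×ˢ X (y * d))
    simp only [Finset.card_product] at h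
    have h' : (T.card : ℝ) ≤ ((∑ d, (X d).card * (X (y * d)).card : ℕ) : ℝ) := by
      exact_mod_cast h
    refine h'.trans (le_of_eq ?_)
    rw [corr, Nat.cast_sum]
    refine Finset.sum_congr rfl fun d _ => ?_
    rw [Nat.cast_mul]
    simp only [diffs, X]
    congr!
  have h5 : R.card ≤ C.card ^ 2 + T.card := by
    refine (Finset.card_union_le _ _).trans (Nat.add_le_add_right ?_ _)
    rw [sq, ← Finset.card_product]
    exact Finset.card_image_le
  have h6 : (Q.card : ℝ) ≤ (C.card : ℝ) ^ 2 + T.card := by exact_mod_cast h3.trans h5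
  calc (C.card : ℝ) ^ 4 ≤ W.card * Q.card := by exact_mod_cast h2
    _ ≤ _ := by
      gcongr
      linarith

lemma expansion_arith {N M W D e G : ℝ} (hN : 0 < N) (hM : 0 ≤ M) (hW : 0 ≤ W)
    (hG : 1 ≤ G) (h : N ^ 4 ≤ W * (N ^ 2 + e)) (heD : M * e ^ 2 ≤ D)
    (hD : D ^ 13 ≤ G ^ 3 * N ^ 84) :
    min (M ^ (1 / 2 : ℝ) * N ^ (10 / 13 : ℝ)) (N ^ 2) ≤ 2 * G * W := by
  rcases le_total e (N ^ 2) with h1 | h1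
  · refine (min_le_right _ _).trans ?_
    have h2 : N ^ 2 * N ^ 2 ≤ (2 * W) * N ^ 2 := by nlinarith
    have h3 := le_of_mul_le_mul_right h2 (by positivity)
    nlinarith
  · refine (min_le_left _ _).trans ?_
    have h2 : N ^ 4 ≤ 2 * W * e := by nlinarith
    have h3 : N ^ 8 * M ≤ 4 * W ^ 2 * D := by
      calc N ^ 8 * M = (N ^ 4) ^ 2 * M := by ring
        _ ≤ (2 * W * e) ^ 2 * M := by gcongr
        _ = 4 * W ^ 2 * (M * e ^ 2) := by ring
        _ ≤ _ := by gcongr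
    have h4 : (M ^ 13 * N ^ 20) * N ^ 84 ≤ (2 * G * W) ^ 26 * N ^ 84 := by
      calc (M ^ 13 * N ^ 20) * N ^ 84 = (N ^ 8 * M) ^ 13 := by ring
        _ ≤ (4 * W ^ 2 * D) ^ 13 := by gcongr
        _ = (2 * W) ^ 26 * D ^ 13 := by ring
        _ ≤ (2 * W) ^ 26 * (G ^ 3 * N ^ 84) := by gcongr
        _ ≤ (2 * W) ^ 26 * (G ^ 26 * N ^ 84) := by
          gcongr
          norm_num
        _ = _ := by ring
    have h5 := le_of_mul_le_mul_right h4 (by positivity)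
    refine le_of_pow_le_pow_left₀ (n := 26) (by norm_num) (by positivity) (le_of_eq_of_le ?_ h5)
    rw [mul_pow, ← Real.rpow_mul_natCast hM, ← Real.rpow_mul_natCast hN.le,
      ← Real.rpow_natCast M 13, ← Real.rpow_natCast N 20]
    norm_num

lemma exists_min_le_card_image [Fintype F] [DecidableEq F] {p : ℕ} [CharP F p]
    (hF : Fintype.card Fˣ ≤ p) (C : Finset F) (hC : C.card ^ 2 ≤ p) {K : ℕ} (hK0 : 1 ≤ K)
    (hK : C.card ^ 3 < 2 ^ K) (Y : Finset Fˣ) (hY : Y.Nonempty) :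
    ∃ y ∈ Y, min ((Y.card : ℝ) ^ (1 / 2 : ℝ) * (C.card : ℝ) ^ (10 / 13 : ℝ)) ((C.card : ℝ) ^ 2) ≤
      2 * (10 ^ 73 * (K : ℝ) ^ 11) * ((C ×ˢ C).image fun z => z.1 * (y : F) + z.2).card := by
  rcases C.eq_empty_or_nonempty with rfl | hC0
  · obtain ⟨y, hy⟩ := hY
    exact ⟨y, hy, by simp⟩
  have hd := diffs_nonneg C
  obtain ⟨y, hy, h⟩ := Finset.exists_le_of_sum_le
    (f := fun y => (Y.card : ℝ) * corr (diffs C) y ^ 2) (g := fun _ => ∑ q, corr (diffs C) q ^ 2) hY (by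
      rw [← Finset.mul_sum, Finset.sum_const, nsmul_eq_mul]
      exact mul_le_mul_of_nonneg_left (Finset.sum_le_sum_of_subset_of_nonneg
        (Finset.subset_univ _) fun q _ _ => sq_nonneg _) (Nat.cast_nonneg _))
  refine ⟨y, hy, expansion_arith (by exact_mod_cast hC0.card_pos) (Nat.cast_nonneg _)
    (Nat.cast_nonneg _) ?_ (card_pow_four_le C y) h
    (sum_corr_diffs_sq_pow_le hF C hC hC0 hK)⟩
  have hK1 : (1 : ℝ) ≤ (K : ℝ) ^ 11 := one_le_pow₀ (Nat.one_le_cast.2 hK0)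
  linarith

lemma exists_log_pow_le (ε : ℝ) (hε : 0 < ε) : ∃ A : ℝ, 0 < A ∧ ∀ p : ℕ, 1 ≤ p →
    ((Nat.log 2 (p ^ 2) + 1 : ℕ) : ℝ) ^ 11 ≤ A * (p : ℝ) ^ ε := by
  have hl : 0 < Real.log 2 := Real.log_pos one_lt_two
  refine ⟨(2 / ((ε / 11) * Real.log 2) + 1) ^ 11, by positivity, fun p hp => ?_⟩
  have hp1 : (1 : ℝ) ≤ p := by exact_mod_cast hp
  have h1 : (Nat.log 2 (p ^ 2) : ℝ) * Real.log 2 ≤ 2 * Real.log p := by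
    have h2 : ((2 : ℝ)) ^ Nat.log 2 (p ^ 2) ≤ (p : ℝ) ^ 2 := by
      exact_mod_cast Nat.pow_log_le_self 2 (pow_ne_zero 2 (by omega : p ≠ 0))
    have h3 := Real.log_le_log (by positivity) h2
    rw [Real.log_pow, Real.log_pow] at h3
    exact_mod_cast h3
  have h2 := Real.log_le_rpow_div (x := p) (ε := ε / 11) (by linarith) (by linarith)
  have h3 : (1 : ℝ) ≤ (p : ℝ) ^ (ε / 11) := Real.one_le_rpow hp1 (by linarith)
  have h4 : ((Nat.log 2 (p ^ 2) + 1 : ℕ) : ℝ) ≤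
      (2 / ((ε / 11) * Real.log 2) + 1) * (p : ℝ) ^ (ε / 11) := by
    have h5 : (Nat.log 2 (p ^ 2) : ℝ) ≤ 2 / ((ε / 11) * Real.log 2) * (p : ℝ) ^ (ε / 11) := by
      refine le_of_mul_le_mul_right (h1.trans ?_) hl
      calc 2 * Real.log p ≤ 2 * ((p : ℝ) ^ (ε / 11) / (ε / 11)) := by linarith
        _ = _ := by field_simp
    push_cast
    linarith
  calc ((Nat.log 2 (p ^ 2) + 1 : ℕ) : ℝ) ^ 11 ≤
      ((2 / ((ε / 11) * Real.log 2) + 1) * (p : ℝ) ^ (ε / 11)) ^ 11 := by gcongr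
    _ = _ := by
      rw [mul_pow, ← Real.rpow_mul_natCast (by linarith)]
      norm_num

end SecondMoment

end Incidence

/-- over a prime field, if `|C| ≤ p^{1/2}` and `Y ⊆ F_p^*` is nonempty,
there is `y ∈ Y` with
`#{ay + b : (a,b) ∈ C × C} ≳ min(|Y|^{1/2}|C|^{10/13}, |C|^2)`. -/
theorem statement15 :
    ∀ ε : ℝ, 0 < ε →
      ∃ cε : ℝ, 0 < cε ∧
        ∀ (p : ℕ) [Fact p.Prime] (Y C : Set (ZMod p)),
          Y.Nonempty → (0 : ZMod p) ∉ Y →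
          (C.ncard : ℝ) ≤ (p : ℝ) ^ (1/2 : ℝ) →
          ∃ y ∈ Y,
            cε * (p : ℝ) ^ (-ε) *
                min ((Y.ncard : ℝ) ^ (1/2 : ℝ) * (C.ncard : ℝ) ^ (10/13 : ℝ))
                    ((C.ncard : ℝ) ^ (2 : ℕ)) ≤
              (((fun z : ZMod p × ZMod p => z.1 * y + z.2) '' (C ×ˢ C)).ncard : ℝ) := by
  classical
  intro ε hε
  obtain ⟨A, hA, hlog⟩ := Incidence.exists_log_pow_le ε hε
  refine ⟨1 / (2 * 10 ^ 73 * A), by positivity, fun p _ Y C hY hY0 hC => ?_⟩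
  have hp := (Fact.out : p.Prime)
  have hp0 : (0 : ℝ) < p := by exact_mod_cast hp.pos
  set Z : Finset (ZMod p)ˣ := Finset.univ.filter fun u => (u : ZMod p) ∈ Y
  have hZ : (Z.card : ℝ) = Y.ncard := by
    have e : Y = ((Z.image fun u : (ZMod p)ˣ => (u : ZMod p) : Finset (ZMod p)) : Set (ZMod p)) := by
      ext y
      simp only [Finset.coe_image, Set.mem_image, Finset.mem_coe, Z, Finset.mem_filter,
        Finset.mem_univ, true_and]
      refine ⟨fun hy => ?_, ?_⟩
      · have hy0 : y ≠ 0 := fun h => hY0 (h ▸ hy)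
        exact ⟨Units.mk0 y hy0, hy, rfl⟩
      · rintro ⟨u, hu, rfl⟩
        exact hu
    rw [e, Set.ncard_coe_finset, Finset.card_image_of_injective _ Units.val_injective]
  have hZ0 : Z.Nonempty := by
    obtain ⟨y, hy⟩ := hY
    have hy0 : y ≠ 0 := fun h => hY0 (h ▸ hy)
    exact ⟨Units.mk0 y hy0, Finset.mem_filter.2 ⟨Finset.mem_univ _, hy⟩⟩
  have hCc : C.ncard = C.toFinset.card := Set.ncard_eq_toFinset_card' C
  have hC2 : C.toFinset.card ^ 2 ≤ p := by
    rw [← hCc]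
    have h : (C.ncard : ℝ) ^ 2 ≤ (p : ℝ) := by
      calc (C.ncard : ℝ) ^ 2 ≤ ((p : ℝ) ^ (1 / 2 : ℝ)) ^ 2 := by gcongr
        _ = (p : ℝ) := by
          rw [← Real.rpow_mul_natCast hp0.le]
          norm_num
    exact_mod_cast h
  have hK : C.toFinset.card ^ 3 < 2 ^ (Nat.log 2 (p ^ 2) + 1) := by
    refine lt_of_le_of_lt ?_ (Nat.lt_pow_succ_log_self one_lt_two (p ^ 2))
    calc C.toFinset.card ^ 3 ≤ C.toFinset.card ^ 4 := by
          rcases Nat.eq_zero_or_pos C.toFinset.card with h | h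
          · simp [h]
          · exact Nat.pow_le_pow_right h (by norm_num)
      _ = (C.toFinset.card ^ 2) ^ 2 := by ring
      _ ≤ p ^ 2 := Nat.pow_le_pow_left hC2 2
  obtain ⟨y, hy, h⟩ := Incidence.exists_min_le_card_image (p := p)
    (by rw [ZMod.card_units]; omega) C.toFinset hC2 (by omega) hK Z hZ0
  refine ⟨y, (Finset.mem_filter.1 hy).2, ?_⟩
  have e : (fun z : ZMod p × ZMod p => z.1 * (y : ZMod p) + z.2) '' (C ×ˢ C) =
      ((C.toFinset ×ˢ C.toFinset).image fun z => z.1 * (y : ZMod p) + z.2 : Finset (ZMod p)) := by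
    simp
  rw [e, Set.ncard_coe_finset, hCc, ← hZ]
  set m := min ((Z.card : ℝ) ^ (1 / 2 : ℝ) * (C.toFinset.card : ℝ) ^ (10 / 13 : ℝ))
    ((C.toFinset.card : ℝ) ^ 2)
  set W : ℝ := (((C.toFinset ×ˢ C.toFinset).image
    fun z => z.1 * (y : ZMod p) + z.2 : Finset (ZMod p)).card : ℝ)
  have hW : 0 ≤ W := Nat.cast_nonneg _
  have h1 := hlog p hp.one_lt.le
  have h2 : m ≤ 2 * 10 ^ 73 * A * (p : ℝ) ^ ε * W := by
    refine h.trans ?_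
    calc 2 * (10 ^ 73 * ((Nat.log 2 (p ^ 2) + 1 : ℕ) : ℝ) ^ 11) * W ≤
        2 * (10 ^ 73 * (A * (p : ℝ) ^ ε)) * W := by gcongr
      _ = _ := by ring
  have h3 : 0 < (p : ℝ) ^ ε := Real.rpow_pos_of_pos hp0 ε
  calc 1 / (2 * 10 ^ 73 * A) * (p : ℝ) ^ (-ε) * m ≤
      1 / (2 * 10 ^ 73 * A) * (p : ℝ) ^ (-ε) * (2 * 10 ^ 73 * A * (p : ℝ) ^ ε * W) := by gcongr
    _ = W := by
      rw [Real.rpow_neg hp0.le]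
      field_simp
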